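/- Suppose R(n) ≤ c n^H for some H ≥ 0 and c > 0, and α(t)σ(t) ≤ c |t|^{-γ/q} for all t ∈ T with |t| ≥ 1, for some γ > 1. Set p = min{2,q} and 1/p' = 1 − 1/p. Then there is a constant C > 0 such that for all n ≥ 2: e_n(V_{α,σ} : ℓ_1(T) → ℓ_q(T)) ≤ C n^{-(γ−1)/(qH) − 1/p'} if γ < H+1; e_n(V_{α,σ}) ≤ C n^{-1/q − 1/p'} (log n)^{1/q} if γ = H+1; and e_n(V_{α,σ}) ≤ C n^{-γ/(q(H+1)) − 1/p'} if γ > H+1. -/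

import Mathlib

open scoped ENNReal NNReal
open MeasureTheory

noncomputable section

/-- A rooted tree structure on a partially ordered type with bottom element (the root):
the set of ancestors of any node is finite and totally ordered, and every node has
finitely many offspring (covering elements). -/
def IsTree (T : Type) [PartialOrder T] [OrderBot T] : Prop :=
  (∀ s : T, (Set.Iic s).Finite) ∧
  (∀ s a b : T, a ≤ s → b ≤ s → a ≤ b ∨ b ≤ a) ∧
  (∀ t : T, {s : T | t ⋖ s}.Finite)

/-- The binary tree: a rooted tree in which every node has exactly two offspring. -/
def IsBinaryTree (T : Type) [PartialOrder T] [OrderBot T] : Prop :=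
  IsTree T ∧ ∀ t : T, Nat.card {s : T | t ⋖ s} = 2

/-- `glb` assigns to any two nodes their greatest common ancestor. -/
def IsGCA {T : Type} [PartialOrder T] (glb : T → T → T) : Prop :=
  ∀ t s : T, glb t s ≤ t ∧ glb t s ≤ s ∧ ∀ u : T, u ≤ t → u ≤ s → u ≤ glb t s

/-- The generation `|t|` of a node: the number of its strict ancestors. -/
def gen {T : Type} [PartialOrder T] (t : T) : ℕ := Nat.card (Set.Iio t)

/-- The distance `max_{t ≺ v ⪯ s} (∑_{t ≺ r ⪯ v} α(r)^q)^{1/q} σ(v)` along a branch. -/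
def dOrd {T : Type} [PartialOrder T] (q : ℝ) (α σ : T → ℝ) (t s : T) : ℝ :=
  sSup ((fun v => (∑ᶠ r ∈ Set.Ioc t v, α r ^ q) ^ (1 / q) * σ v) '' Set.Ioc t s)

/- The tree metric `d`, extended by symmetry and via greatest common ancestors. -/
open Classical in
def treeDist {T : Type} [PartialOrder T] (q : ℝ) (α σ : T → ℝ)
    (glb : T → T → T) (t s : T) : ℝ :=
  if t ≤ s then dOrd q α σ t s
  else if s ≤ t then dOrd q α σ s t
  else dOrd q α σ (glb t s) t + dOrd q α σ (glb t s) s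

/-- `N(T,d,ε)`: minimal number of open `ε`-balls needed to cover `T` (`∞` if none). -/
def coveringNumber {T : Type} (d : T → T → ℝ) (ε : ℝ) : ℝ≥0∞ :=
  ⨅ S ∈ {S : Finset T | ∀ t : T, ∃ s ∈ S, d s t < ε}, (S.card : ℝ≥0∞)

/-- `Ñ(T,d,ε)`: minimal cardinality of an order `ε`-net of `T`. -/
def orderCoveringNumber {T : Type} [PartialOrder T] (d : T → T → ℝ) (ε : ℝ) : ℝ≥0∞ :=
  ⨅ S ∈ {S : Finset T | ∀ t : T, ∃ s ∈ S, s ≤ t ∧ d s t < ε}, (S.card : ℝ≥0∞)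

/-- Minimal number of open `ε`-balls of a normed space needed to cover the set `A`. -/
def setCoveringNumber {Y : Type} [NormedAddCommGroup Y] (A : Set Y) (ε : ℝ) : ℝ≥0∞ :=
  ⨅ F ∈ {F : Finset Y | ∀ a ∈ A, ∃ y ∈ F, ‖a - y‖ < ε}, (F.card : ℝ≥0∞)

/-- The dyadic entropy numbers `e_n(V)` of an operator `V`. -/
def entropyNumber {X Y : Type} [NormedAddCommGroup X] [NormedSpace ℝ X]
    [NormedAddCommGroup Y] [NormedSpace ℝ Y] (n : ℕ) (V : X →L[ℝ] Y) : ℝ :=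
  sInf {ε : ℝ | 0 < ε ∧ ∃ F : Finset Y, F.card ≤ 2 ^ (n - 1) ∧
    ∀ x : X, ‖x‖ ≤ 1 → ∃ y ∈ F, ‖V x - y‖ < ε}

/-- The space `ℓ₁(T)`. -/
abbrev ellOne (T : Type) := lp (fun _ : T => ℝ) 1

/-- The space `ℓ_q(T)`. -/
abbrev ellQ (T : Type) (q : ℝ) := lp (fun _ : T => ℝ) (ENNReal.ofReal q)

/-- The odd extension of `a ↦ a ^ β` to the real line. -/
def signedPow (β a : ℝ) : ℝ := if 0 ≤ a then a ^ β else -(-a) ^ β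

lemma signedPow_of_nonneg {β a : ℝ} (ha : 0 ≤ a) : signedPow β a = a ^ β := if_pos ha

lemma signedPow_neg {β : ℝ} (hβ : 0 < β) (a : ℝ) : signedPow β (-a) = -signedPow β a := by
  rcases lt_trichotomy a 0 with h | rfl | h
  · simp [signedPow, h.le, not_le.2 h]
  · simp [signedPow, Real.zero_rpow hβ.ne']
  · simp [signedPow, h.le, not_le.2 h]

lemma abs_signedPow (β a : ℝ) : |signedPow β a| = |a| ^ β := by
  unfold signedPow
  split_ifs with h
  · rw [abs_of_nonneg h, abs_of_nonneg (Real.rpow_nonneg h _)]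
  · push Not at h
    rw [abs_neg, abs_of_neg h, abs_of_nonneg (Real.rpow_nonneg (by linarith) _)]

lemma signedPow_mul_self {β : ℝ} (hβ : 0 < β) (a : ℝ) :
    signedPow β a * a = |a| ^ (β + 1) := by
  unfold signedPow
  split_ifs with h
  · rw [abs_of_nonneg h, Real.rpow_add_one' h (by linarith)]
  · push Not at h
    rw [abs_of_neg h, Real.rpow_add_one (by linarith)]
    ring

lemma abs_rpow_sub_rpow_le {β x y : ℝ} (hβ : 0 < β) (hβ1 : β ≤ 1) (hx : 0 ≤ x) (hy : 0 ≤ y) :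
    |x ^ β - y ^ β| ≤ |x - y| ^ β := by
  wlog h : y ≤ x generalizing x y
  · rw [abs_sub_comm, abs_sub_comm x y]
    exact this hy hx (le_of_not_ge h)
  have h1 := Real.rpow_le_rpow hy h hβ.le
  rw [abs_of_nonneg (by linarith), abs_of_nonneg (by linarith)]
  have h2 := Real.rpow_add_le_add_rpow hy (sub_nonneg.2 h) hβ.le hβ1
  rw [add_sub_cancel] at h2
  linarith

lemma abs_signedPow_sub_le {β : ℝ} (hβ : 0 < β) (hβ1 : β ≤ 1) (a b : ℝ) :
    |signedPow β a - signedPow β b| ≤ 2 * |a - b| ^ β := by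
  have key : ∀ a b : ℝ, 0 ≤ a → |signedPow β a - signedPow β b| ≤ 2 * |a - b| ^ β := by
    intro a b ha
    rcases le_total 0 b with hb | hb
    · rw [signedPow_of_nonneg ha, signedPow_of_nonneg hb]
      have := abs_rpow_sub_rpow_le hβ hβ1 ha hb
      have := Real.rpow_nonneg (abs_nonneg (a - b)) β
      linarith
    · have h1 : |signedPow β a - signedPow β b| ≤ |a| ^ β + |b| ^ β := by
        rw [← abs_signedPow, ← abs_signedPow]; exact abs_sub _ _
      have h2 : |a| ^ β ≤ |a - b| ^ β :=
        Real.rpow_le_rpow (abs_nonneg _)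
          (by rw [abs_of_nonneg ha, abs_of_nonneg (by linarith)]; linarith) hβ.le
      have h3 : |b| ^ β ≤ |a - b| ^ β :=
        Real.rpow_le_rpow (abs_nonneg _)
          (by rw [abs_of_nonpos hb, abs_of_nonneg (by linarith)]; linarith) hβ.le
      linarith
  rcases le_total 0 a with ha | ha
  · exact key a b ha
  · have := key (-a) (-b) (by linarith)
    rw [signedPow_neg hβ, signedPow_neg hβ] at this
    rwa [← abs_neg, show -(signedPow β a - signedPow β b) = -signedPow β a - -signedPow β b by ring,
      ← abs_neg (a - b), show -(a - b) = -a - -b by ring]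

/-- Young's inequality for the conjugate exponents `q / (q - 1)` and `q`. -/
lemma rpow_mul_le_young {q : ℝ} (hq : 1 < q) {a s : ℝ} (ha : 0 ≤ a) (hs : 0 ≤ s) :
    q * (a ^ (q - 1) * s) ≤ s ^ q + (q - 1) * a ^ q := by
  have hc : (q / (q - 1)).HolderConjugate q := (Real.HolderConjugate.conjExponent hq).symm
  have := Real.young_inequality_of_nonneg (Real.rpow_nonneg ha (q - 1)) hs hc
  rw [← Real.rpow_mul ha, mul_div_cancel₀ _ (by linarith)] at this
  have hq0 : 0 < q := by linarith
  have h2 : q * (a ^ (q - 1) * s) ≤ q * (a ^ q / (q / (q - 1)) + s ^ q / q) := by gcongr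
  have h3 : q * (a ^ q / (q / (q - 1)) + s ^ q / q) = s ^ q + (q - 1) * a ^ q := by
    have : q - 1 ≠ 0 := by linarith
    field_simp; ring
  linarith

lemma abs_rpow_sub_rpow_le_mul {β x y M : ℝ} (hβ : 1 ≤ β) (hx : 0 ≤ x) (hy : 0 ≤ y)
    (hxM : x ≤ M) (hyM : y ≤ M) :
    |x ^ β - y ^ β| ≤ β * M ^ (β - 1) * |x - y| := by
  wlog h : y ≤ x generalizing x y
  · rw [abs_sub_comm, abs_sub_comm x y]
    exact this hy hx hyM hxM (le_of_not_ge h)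
  rw [abs_of_nonneg (by linarith [Real.rpow_le_rpow hy h (by linarith : 0 ≤ β)]),
    abs_of_nonneg (by linarith)]
  have h0 : x ^ β - y ^ β ≤ β * x ^ (β - 1) * (x - y) := by
    rcases hβ.eq_or_lt with rfl | hβ
    · simp
    · have := rpow_mul_le_young hβ hx hy
      have h1 : x ^ β = x ^ (β - 1) * x := by
        rw [← Real.rpow_add_one' hx (by linarith)]; ring_nf
      rw [h1] at this ⊢
      linarith
  have h1 : x ^ (β - 1) ≤ M ^ (β - 1) := Real.rpow_le_rpow hx hxM (by linarith)
  have h2 : 0 ≤ x - y := by linarith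
  refine h0.trans ?_
  gcongr

lemma abs_signedPow_sub_le_mul {β M : ℝ} (hβ : 1 ≤ β) (a b : ℝ) (haM : |a| ≤ M)
    (hbM : |b| ≤ M) : |signedPow β a - signedPow β b| ≤ β * M ^ (β - 1) * |a - b| := by
  have key : ∀ a b : ℝ, 0 ≤ a → |a| ≤ M → |b| ≤ M →
      |signedPow β a - signedPow β b| ≤ β * M ^ (β - 1) * |a - b| := by
    intro a b ha haM hbM
    rcases le_total 0 b with hb | hb
    · rw [signedPow_of_nonneg ha, signedPow_of_nonneg hb]
      exact abs_rpow_sub_rpow_le_mul hβ ha hb (by rwa [abs_of_nonneg ha] at haM)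
        (by rwa [abs_of_nonneg hb] at hbM)
    · have hM : 0 ≤ M := (abs_nonneg _).trans haM
      have aux : ∀ x : ℝ, |x| ≤ M → |x| ^ β ≤ M ^ (β - 1) * |x| := by
        intro x hx
        have : |x| ^ β = |x| ^ (β - 1) * |x| := by
          rw [← Real.rpow_add_one' (abs_nonneg _) (by linarith)]; ring_nf
        rw [this]
        have := Real.rpow_le_rpow (abs_nonneg x) hx (by linarith : 0 ≤ β - 1)
        gcongr
      have h1 : |signedPow β a - signedPow β b| ≤ |a| ^ β + |b| ^ β := by
        rw [← abs_signedPow, ← abs_signedPow]; exact abs_sub _ _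
      have h2 : |a - b| = |a| + |b| := by
        rw [abs_of_nonneg ha, abs_of_nonpos hb, abs_of_nonneg (by linarith)]; ring
      have h3 : 0 ≤ M ^ (β - 1) * (|a| + |b|) := by positivity
      rw [h2]
      nlinarith [aux a haM, aux b hbM]
  rcases le_total 0 a with ha | ha
  · exact key a b ha haM hbM
  · have := key (-a) (-b) (by linarith) (by simpa) (by simpa)
    rw [signedPow_neg (by linarith), signedPow_neg (by linarith)] at this
    rwa [← abs_neg, show -(signedPow β a - signedPow β b) = -signedPow β a - -signedPow β b by ring,
      ← abs_neg (a - b), show -(a - b) = -a - -b by ring]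

/-- Second order expansion of `|s| ^ q`. -/
lemma abs_add_rpow_le {q p : ℝ} (hq : 1 < q) (hp : p = min 2 q) :
    ∃ C, 0 < C ∧ ∀ s y : ℝ, |s + y| ^ q ≤ |s| ^ q + q * signedPow (q - 1) s * y +
      C * (|s| ^ (q - p) * |y| ^ p + |y| ^ q) := by
  have hq0 : 0 < q - 1 := by linarith
  have start : ∀ s y : ℝ, |s + y| ^ q ≤ |s| ^ q + q * signedPow (q - 1) s * y +
      q * |signedPow (q - 1) (s + y) - signedPow (q - 1) s| * |y| := by
    intro s y
    have h1 := rpow_mul_le_young hq (abs_nonneg (s + y)) (abs_nonneg s)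
    have h2 : signedPow (q - 1) (s + y) * s ≤ |s + y| ^ (q - 1) * |s| := by
      rw [← abs_signedPow, ← abs_mul]; exact le_abs_self _
    have h3 := signedPow_mul_self hq0 (s + y)
    rw [sub_add_cancel] at h3
    have h4 : (signedPow (q - 1) (s + y) - signedPow (q - 1) s) * y ≤
        |signedPow (q - 1) (s + y) - signedPow (q - 1) s| * |y| := by
      rw [← abs_mul]; exact le_abs_self _
    have h5 := mul_le_mul_of_nonneg_left h2 (by linarith : 0 ≤ q)
    have h6 := mul_le_mul_of_nonneg_left h4 (by linarith : 0 ≤ q)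
    nlinarith
  rcases le_total q 2 with h | h
  · rw [min_eq_right h] at hp
    subst hp
    refine ⟨2 * p, by linarith, fun s y => (start s y).trans ?_⟩
    have h1 := abs_signedPow_sub_le hq0 (by linarith) (s + y) s
    rw [add_sub_cancel_left] at h1
    have h2 : |y| ^ p = |y| ^ (p - 1) * |y| := by
      rw [← Real.rpow_add_one' (abs_nonneg _) (by linarith)]; ring_nf
    have h3 : p * |signedPow (p - 1) (s + y) - signedPow (p - 1) s| * |y| ≤
        p * (2 * |y| ^ (p - 1)) * |y| := by gcongr
    rw [sub_self, Real.rpow_zero, h2]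
    have : 0 ≤ p * (|y| ^ (p - 1) * |y|) := by positivity
    linarith
  · rw [min_eq_left h] at hp
    subst hp
    refine ⟨q * ((q - 1) * 2 ^ (q - 2)), by positivity, fun s y => (start s y).trans ?_⟩
    have h1 := abs_signedPow_sub_le_mul (M := |s| + |y|) (by linarith : 1 ≤ q - 1) (s + y) s
      (abs_add_le _ _) (by linarith [abs_nonneg y])
    rw [add_sub_cancel_left, show q - 1 - 1 = q - 2 by ring] at h1
    have h2 : (|s| + |y|) ^ (q - 2) ≤ 2 ^ (q - 2) * (|s| ^ (q - 2) + |y| ^ (q - 2)) := by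
      have hm : |s| + |y| ≤ 2 * max |s| |y| := by
        linarith [le_max_left |s| |y|, le_max_right |s| |y|]
      refine (Real.rpow_le_rpow (by positivity) hm (by linarith)).trans ?_
      rw [Real.mul_rpow (by norm_num) (by positivity)]
      gcongr
      rcases max_choice |s| |y| with h | h <;> rw [h]
      · linarith [Real.rpow_nonneg (abs_nonneg y) (q - 2)]
      · linarith [Real.rpow_nonneg (abs_nonneg s) (q - 2)]
    have h3 : |y| ^ q = |y| ^ (q - 2) * |y| ^ (2 : ℝ) := by
      rw [← Real.rpow_add' (abs_nonneg _) (by linarith)]; ring_nf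
    have h4 : q * |signedPow (q - 1) (s + y) - signedPow (q - 1) s| * |y| ≤
        q * ((q - 1) * (2 ^ (q - 2) * (|s| ^ (q - 2) + |y| ^ (q - 2))) * |y|) * |y| := by
      gcongr
      refine h1.trans ?_
      gcongr
    rw [h3]
    refine (add_le_add_right h4 _).trans (le_of_eq ?_)
    simp only [Real.rpow_ofNat]
    ring

lemma ellQ_hasSum {T : Type} {q : ℝ} (hq : 1 < q) (f : ellQ T q) :
    HasSum (fun t => |f t| ^ q) (‖f‖ ^ q) := by
  have hq' : (ENNReal.ofReal q).toReal = q := ENNReal.toReal_ofReal (by linarith)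
  have := lp.hasSum_norm (p := ENNReal.ofReal q) (by rw [hq']; linarith) f
  simpa [hq'] using this

lemma summable_signedPow_mul {T : Type} {q : ℝ} (hq : 1 < q) (S y : ellQ T q) :
    Summable fun t => q * signedPow (q - 1) (S t) * y t := by
  refine Summable.of_norm_bounded
    ((ellQ_hasSum hq y).summable.add ((ellQ_hasSum hq S).summable.mul_left (q - 1))) fun t => ?_
  rw [Real.norm_eq_abs, abs_mul, abs_mul, abs_signedPow, abs_of_pos (by linarith : 0 < q),
    mul_assoc]
  exact rpow_mul_le_young hq (abs_nonneg _) (abs_nonneg _)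

/-- The derivative of `S ↦ ‖S‖ ^ q` on `ℓ_q`. -/
def normRpowDeriv {T : Type} {q : ℝ} (hq : 1 < q) (S : ellQ T q) : ellQ T q →ₗ[ℝ] ℝ where
  toFun y := ∑' t, q * signedPow (q - 1) (S t) * y t
  map_add' y z := by
    rw [← (summable_signedPow_mul hq S y).tsum_add (summable_signedPow_mul hq S z)]
    simp [mul_add]
  map_smul' a y := by
    rw [RingHom.id_apply, smul_eq_mul, ← tsum_mul_left]
    congr 1 with t
    simp only [lp.coeFn_smul, Pi.smul_apply, smul_eq_mul]
    ring

lemma ellQ_holder {T : Type} {q p : ℝ} [Fact (1 ≤ ENNReal.ofReal q)] (hq : 1 < q) (hp : 0 < p)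
    (hpq : p ≤ q)
    (S y : ellQ T q) :
    ∃ A ≤ ‖S‖ ^ (q - p) * ‖y‖ ^ p, HasSum (fun t => |S t| ^ (q - p) * |y t| ^ p) A := by
  rcases hpq.eq_or_lt with rfl | hlt
  · refine ⟨‖y‖ ^ p, by simp, ?_⟩
    simpa using ellQ_hasSum hq y
  · have hqp : 0 < q - p := by linarith
    have hc : (q / (q - p)).HolderConjugate (q / p) := by
      rw [Real.holderConjugate_iff]
      refine ⟨by rw [lt_div_iff₀ hqp]; linarith, ?_⟩
      field_simp; ring
    have e1 : ∀ a : ℝ, 0 ≤ a → (a ^ (q - p)) ^ (q / (q - p)) = a ^ q := fun a ha => by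
      rw [← Real.rpow_mul ha, mul_div_cancel₀ _ hqp.ne']
    have e2 : ∀ a : ℝ, 0 ≤ a → (a ^ p) ^ (q / p) = a ^ q := fun a ha => by
      rw [← Real.rpow_mul ha, mul_div_cancel₀ _ hp.ne']
    obtain ⟨A, -, hA, hs⟩ := Real.inner_le_Lp_mul_Lq_hasSum_of_nonneg hc
      (A := ‖S‖ ^ (q - p)) (B := ‖y‖ ^ p) (f := fun t => |S t| ^ (q - p))
      (g := fun t => |y t| ^ p)
      (by positivity) (by positivity) (fun t => by positivity) (fun t => by positivity)
      (by rw [e1 _ (norm_nonneg _)]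
          exact (funext fun t => (e1 _ (abs_nonneg (S t))).symm) ▸ ellQ_hasSum hq S)
      (by rw [e2 _ (norm_nonneg _)]
          exact (funext fun t => (e2 _ (abs_nonneg (y t))).symm) ▸ ellQ_hasSum hq y)
    exact ⟨A, hA, hs⟩

lemma ellQ_norm_add_rpow_le {T : Type} {q p : ℝ} (hq : 1 < q) (hp : p = min 2 q)
    [Fact (1 ≤ ENNReal.ofReal q)] :
    ∃ C, 0 < C ∧ ∀ S y : ellQ T q, ‖S + y‖ ^ q ≤ ‖S‖ ^ q + normRpowDeriv hq S y +
      C * (‖S‖ ^ (q - p) * ‖y‖ ^ p + ‖y‖ ^ q) := by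
  obtain ⟨C, hC, h⟩ := abs_add_rpow_le hq hp
  refine ⟨C, hC, fun S y => ?_⟩
  obtain ⟨A, hA, hs⟩ := ellQ_holder (p := p) hq (by rw [hp]; positivity)
    (by rw [hp]; exact min_le_right _ _)
    S y
  have h1 := ((ellQ_hasSum hq S).add (summable_signedPow_mul hq S y).hasSum).add
    ((hs.add (ellQ_hasSum hq y)).mul_left C)
  refine (hasSum_le (fun t => ?_) (ellQ_hasSum hq (S + y)) h1).trans ?_
  · exact h (S t) (y t)
  · gcongr
    exact le_refl _

/-- Maurey's empirical approximation property: a point of the convex hull of a subset `P` of the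
unit ball is approximated by the mean of `l` points of `P` up to an error `C * l ^ (-r)`. -/
def MaureyApprox (Y : Type) [NormedAddCommGroup Y] [NormedSpace ℝ Y] (C r : ℝ) : Prop :=
  ∀ (P : Set Y) (x : Y), (∀ y ∈ P, ‖y‖ ≤ 1) → x ∈ convexHull ℝ P → ∀ l : ℕ, 1 ≤ l →
    ∃ m : Multiset Y, m.card = l ∧ (∀ y ∈ m, y ∈ P) ∧
      ‖x - (l : ℝ)⁻¹ • m.sum‖ ≤ C * (l : ℝ) ^ (-r)

lemma exists_mem_le_of_mem_convexHull {E : Type} [AddCommGroup E] [Module ℝ E] {P : Set E} {x : E}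
    (hx : x ∈ convexHull ℝ P) (f : E →ₗ[ℝ] ℝ) : ∃ y ∈ P, f y ≤ f x := by
  by_contra! h
  have h1 : convexHull ℝ P ⊆ {w | f x < f w} :=
    convexHull_min (fun y hy => h y hy) (convex_halfSpace_gt f.isLinear _)
  exact lt_irrefl (f x) (h1 hx)

/-- Bernoulli-type recursion step. -/
lemma recursion_step {e K B C a : ℝ} {j : ℕ} (he : 1 ≤ e) (hK : 1 ≤ K) (hC : 0 ≤ C) (hB : 0 ≤ B)
    (hCB : C + B ≤ K)
    (ha0 : 0 ≤ a) (ha : a ≤ (K * j) ^ e) :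
    a + (B * a ^ ((e - 1) / e) + C) ≤ (K * (j + 1 : ℕ)) ^ e := by
  rcases Nat.eq_zero_or_pos j with rfl | hj
  · have : a = 0 := by
      rw [Nat.cast_zero, mul_zero, Real.zero_rpow (by linarith)] at ha; linarith
    subst this
    have h1 : (0 : ℝ) ^ ((e - 1) / e) ≤ 1 :=
      Real.rpow_le_one le_rfl zero_le_one (div_nonneg (by linarith) (by linarith))
    have h2 : K ^ (1 : ℝ) ≤ K ^ e := Real.rpow_le_rpow_of_exponent_le hK he
    rw [Real.rpow_one] at h2
    simp only [zero_add, Nat.cast_one, mul_one]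
    nlinarith
  · have hj' : (1 : ℝ) ≤ j := by exact_mod_cast hj
    have hKj : 1 ≤ K * j := by nlinarith
    have h1 : a ^ ((e - 1) / e) ≤ (K * j) ^ (e - 1) := by
      refine (Real.rpow_le_rpow ha0 ha (div_nonneg (by linarith) (by linarith))).trans ?_
      rw [← Real.rpow_mul (by linarith), mul_div_cancel₀ _ (by linarith)]
    have h2 : 1 ≤ (K * j) ^ (e - 1) := Real.one_le_rpow hKj (by linarith)
    have h3 : (K * j) ^ e + K * (K * j) ^ (e - 1) ≤ (K * (j + 1 : ℕ)) ^ e := by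
      have hb := one_add_mul_self_le_rpow_one_add (s := 1 / (j : ℝ))
        (by have : 0 ≤ 1 / (j : ℝ) := by positivity
            linarith) he
      have e1 : K * (j + 1 : ℕ) = (K * j) * (1 + 1 / (j : ℝ)) := by
        push_cast; field_simp
      have e2 : (K * j) ^ e = (K * j) * (K * j) ^ (e - 1) := by
        rw [mul_comm _ ((K * j) ^ (e - 1)), ← Real.rpow_add_one (by linarith), sub_add_cancel]
      rw [e1, Real.mul_rpow (x := K * j) (y := 1 + 1 / (j : ℝ)) (by linarith) (by positivity)]
      refine le_trans ?_ (mul_le_mul_of_nonneg_left hb (by positivity : 0 ≤ (K * j) ^ e))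
      rw [e2]
      have : (K * j) * (K * j) ^ (e - 1) * (1 + e * (1 / (j : ℝ))) =
        (K * j) * (K * j) ^ (e - 1) + e * (K * (K * j) ^ (e - 1)) := by field_simp
      rw [this]
      have : 0 ≤ K * (K * j) ^ (e - 1) := by positivity
      nlinarith
    nlinarith

lemma ellQ_maureyApprox {T : Type} {q p : ℝ} (hq : 1 < q) (hp : p = min 2 q)
    [Fact (1 ≤ ENNReal.ofReal q)] : ∃ C, 0 < C ∧ MaureyApprox (ellQ T q) C (1 - 1 / p) := by
  obtain ⟨C, hC, h⟩ := ellQ_norm_add_rpow_le (T := T) hq hp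
  have hp0 : 0 < p := by rw [hp]; positivity
  have hpq : p ≤ q := by rw [hp]; exact min_le_right _ _
  set K : ℝ := 1 + (C * 2 ^ q + C * 2 ^ p) with hKdef
  have hK : 1 ≤ K := by
    have : 0 ≤ C * 2 ^ q + C * 2 ^ p := by positivity
    linarith
  have he : 1 ≤ q / p := by rwa [le_div_iff₀ hp0, one_mul]
  refine ⟨K ^ (1 / p), by positivity, fun P x hP hx l hl => ?_⟩
  have hx1 : ‖x‖ ≤ 1 := by
    have : convexHull ℝ P ⊆ Metric.closedBall 0 1 :=
      convexHull_min (fun y hy => by simpa using hP y hy) (convex_closedBall _ _)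
    simpa using this hx
  have key : ∀ j : ℕ, ∃ m : Multiset (ellQ T q), m.card = j ∧ (∀ y ∈ m, y ∈ P) ∧
      ‖m.sum - (j : ℝ) • x‖ ^ q ≤ (K * j) ^ (q / p) := by
    intro j
    induction j with
    | zero =>
      refine ⟨0, rfl, by simp, ?_⟩
      simp [Real.zero_rpow (by linarith : q ≠ 0), Real.zero_rpow (by linarith : q / p ≠ 0)]
    | succ j ih =>
      obtain ⟨m, hm, hmP, hmn⟩ := ih
      set S := m.sum - (j : ℝ) • x with hS
      obtain ⟨y, hy, hyx⟩ := exists_mem_le_of_mem_convexHull hx (normRpowDeriv hq S)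
      refine ⟨y ::ₘ m, by simp [hm], ?_, ?_⟩
      · intro z hz
        rcases Multiset.mem_cons.1 hz with rfl | hz
        · exact hy
        · exact hmP z hz
      have e1 : (y ::ₘ m).sum - ((j + 1 : ℕ) : ℝ) • x = S + (y - x) := by
        rw [Multiset.sum_cons, hS]; push_cast; module
      rw [e1]
      have h1 := h S (y - x)
      rw [map_sub] at h1
      have h2 : ‖y - x‖ ≤ 2 := (norm_sub_le _ _).trans (by linarith [hP y hy])
      have h3 : ‖y - x‖ ^ p ≤ 2 ^ p := Real.rpow_le_rpow (norm_nonneg _) h2 hp0.le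
      have h4 : ‖y - x‖ ^ q ≤ 2 ^ q := Real.rpow_le_rpow (norm_nonneg _) h2 (by linarith)
      have h5 : ‖S‖ ^ (q - p) = (‖S‖ ^ q) ^ ((q / p - 1) / (q / p)) := by
        rw [← Real.rpow_mul (norm_nonneg _)]
        congr 1
        field_simp
      refine le_trans ?_ (recursion_step (B := C * 2 ^ p) (C := C * 2 ^ q) he hK (by positivity)
        (by positivity) (by rw [hKdef]; linarith) (by positivity) hmn)
      rw [← h5]
      have h6 : ‖S‖ ^ (q - p) * ‖y - x‖ ^ p ≤ ‖S‖ ^ (q - p) * 2 ^ p := by gcongr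
      have h7 : C * (‖S‖ ^ (q - p) * ‖y - x‖ ^ p + ‖y - x‖ ^ q) ≤
        C * (‖S‖ ^ (q - p) * 2 ^ p + 2 ^ q) := by gcongr
      linarith
  obtain ⟨m, hm, hmP, hmn⟩ := key l
  refine ⟨m, hm, hmP, ?_⟩
  have hl0 : (0 : ℝ) < l := by exact_mod_cast hl
  have e1 : x - (l : ℝ)⁻¹ • m.sum = -((l : ℝ)⁻¹ • (m.sum - (l : ℝ) • x)) := by
    rw [smul_sub, smul_smul, inv_mul_cancel₀ hl0.ne']; module
  rw [e1, norm_neg, norm_smul, Real.norm_eq_abs, abs_of_pos (by positivity)]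
  have h1 : ‖m.sum - (l : ℝ) • x‖ ≤ (K * l) ^ (1 / p) := by
    have := Real.rpow_le_rpow (by positivity) hmn (by positivity : 0 ≤ 1 / q)
    rw [← Real.rpow_mul (norm_nonneg _), ← Real.rpow_mul (by positivity),
      mul_one_div_cancel (by linarith : q ≠ 0), Real.rpow_one] at this
    convert this using 2
    field_simp
  refine (mul_le_mul_of_nonneg_left h1 (by positivity)).trans (le_of_eq ?_)
  rw [Real.mul_rpow (by linarith) hl0.le, neg_sub, Real.rpow_sub_one hl0.ne']
  field_simp

lemma MaureyApprox.exists_cover {Y : Type} [NormedAddCommGroup Y] [NormedSpace ℝ Y] {C r : ℝ}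
    (h : MaureyApprox Y C r) (P : Finset Y) (hP : ∀ y ∈ P, ‖y‖ ≤ 1) {N l : ℕ}
    (hN : P.card ≤ N + 1) (hl : 1 ≤ l) :
    ∃ F : Finset Y, F.card ≤ (N + l).choose l ∧
      ∀ x ∈ convexHull ℝ (P : Set Y), ∃ y ∈ F, ‖x - y‖ ≤ C * (l : ℝ) ^ (-r) := by
  classical
  refine ⟨Finset.univ.image fun m : Sym P l =>
    (l : ℝ)⁻¹ • ((m : Multiset P).map Subtype.val).sum, ?_, fun x hx => ?_⟩
  · refine Finset.card_image_le.trans ?_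
    rw [Finset.card_univ, Sym.card_sym_eq_choose, Fintype.card_coe]
    exact Nat.choose_le_choose _ (by omega)
  · obtain ⟨m, hm, hmP, hmx⟩ := h P x (fun y hy => hP y hy) hx l hl
    refine ⟨_, Finset.mem_image.2 ⟨⟨m.attach.map fun y => ⟨y.1, hmP y.1 y.2⟩, by simpa using hm⟩,
      Finset.mem_univ _, rfl⟩, ?_⟩
    simpa [Multiset.map_map, Function.comp_def] using hmx

lemma MaureyApprox.exists_cover_sum {Y : Type} [NormedAddCommGroup Y] [NormedSpace ℝ Y] {C r : ℝ}
    (h : MaureyApprox Y C r) (P : ℕ → Finset Y) (hP : ∀ k, ∀ y ∈ P k, ‖y‖ ≤ 1) (N l : ℕ → ℕ)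
    (hN : ∀ k, (P k).card ≤ N k + 1) (ρ : ℕ → ℝ) (hρ : ∀ k, 0 ≤ ρ k) (K : ℕ)
    (hl : ∀ k < K, 1 ≤ l k) :
    ∃ F : Finset Y, F.card ≤ ∏ k ∈ Finset.range K, (N k + l k).choose (l k) ∧
      ∀ a : ℕ → Y, (∀ k, a k ∈ convexHull ℝ (P k : Set Y)) → ∃ y ∈ F,
        ‖∑ k ∈ Finset.range K, ρ k • a k - y‖ ≤
          C * ∑ k ∈ Finset.range K, ρ k * (l k : ℝ) ^ (-r) := by
  classical
  induction K with
  | zero => exact ⟨{0}, by simp, fun a _ => ⟨0, by simp⟩⟩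
  | succ K ih =>
    obtain ⟨F, hF, hFa⟩ := ih fun k hk => hl k (by omega)
    obtain ⟨G, hG, hGa⟩ := h.exists_cover (P K) (hP K) (hN K) (hl K (by omega))
    refine ⟨Finset.image₂ (fun y z => y + ρ K • z) F G, ?_, fun a ha => ?_⟩
    · rw [Finset.prod_range_succ]
      exact (Finset.card_image₂_le _ _ _).trans (Nat.mul_le_mul hF hG)
    · obtain ⟨y, hy, hya⟩ := hFa a ha
      obtain ⟨z, hz, hza⟩ := hGa (a K) (ha K)
      refine ⟨_, Finset.mem_image₂_of_mem hy hz, ?_⟩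
      rw [Finset.sum_range_succ, Finset.sum_range_succ]
      have e : ∑ k ∈ Finset.range K, ρ k • a k + ρ K • a K - (y + ρ K • z) =
        (∑ k ∈ Finset.range K, ρ k • a k - y) + ρ K • (a K - z) := by module
      rw [e]
      refine (norm_add_le _ _).trans ?_
      rw [norm_smul, Real.norm_of_nonneg (hρ K)]
      have := mul_le_mul_of_nonneg_left hza (hρ K)
      linarith

lemma log_choose_le (n i : ℕ) {x : ℝ} (hx : 0 < x) (hi : i ≤ n) :
    Real.log (n.choose i) ≤ n * x - i * Real.log x := by
  have hpos : (0 : ℝ) < n.choose i := by exact_mod_cast Nat.choose_pos hi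
  have h1 : x ^ i * (n.choose i : ℝ) ≤ (x + 1) ^ n := by
    rw [add_pow]
    refine le_trans (le_of_eq ?_) (Finset.single_le_sum
      (f := fun m => x ^ m * 1 ^ (n - m) * (n.choose m : ℝ)) (fun j _ => by positivity)
      (Finset.mem_range.2 (Nat.lt_succ_of_le hi)))
    simp
  have h2 := Real.log_le_log (by positivity) h1
  rw [Real.log_mul (by positivity) hpos.ne', Real.log_pow, Real.log_pow] at h2
  have h3 : Real.log (x + 1) ≤ x := by linarith [Real.log_le_sub_one_of_pos (by linarith : 0 < x + 1)]
  have h4 : (n : ℝ) * Real.log (x + 1) ≤ n * x := by gcongr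
  linarith

lemma sum_range_dist_le {f : ℕ → ℝ} (hf : ∀ n, 0 ≤ f n) (hs : Summable f) (m K : ℕ) :
    ∑ k ∈ Finset.range K, f (Nat.dist k m) ≤ 2 * ∑' n, f n := by
  have h1 : ∑ k ∈ Finset.range K, f (Nat.dist k m) ≤
      ∑ k ∈ Finset.range ((m + 1) + K), f (Nat.dist k m) :=
    Finset.sum_le_sum_of_subset_of_nonneg (Finset.range_subset_range.2 (by omega))
      fun _ _ _ => hf _
  rw [Finset.sum_range_add] at h1
  have h2 : ∑ k ∈ Finset.range (m + 1), f (Nat.dist k m) ≤ ∑' n, f n := by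
    rw [← Finset.sum_range_reflect]
    refine le_trans (le_of_eq (Finset.sum_congr rfl fun k hk => ?_))
      (hs.sum_le_tsum (Finset.range (m + 1)) fun _ _ => hf _)
    rw [Finset.mem_range] at hk
    congr 1
    rw [Nat.dist_eq_sub_of_le (by omega)]
    omega
  have h3 : ∑ k ∈ Finset.range K, f (Nat.dist (m + 1 + k) m) ≤ ∑' n, f n := by
    have e : ∀ k, Nat.dist (m + 1 + k) m = k + 1 := fun k => by
      rw [Nat.dist_eq_sub_of_le_right (by omega)]; omega
    simp_rw [e]
    have := hs.sum_le_tsum (Finset.range (K + 1)) fun _ _ => hf _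
    rw [Finset.sum_range_succ'] at this
    linarith [hf 0]
  linarith

lemma summable_mul_two_rpow_neg {δ : ℝ} (hδ : 0 < δ) :
    Summable fun n : ℕ => ((n : ℝ) + 1) * 2 ^ (-(δ * n)) := by
  have hr : ‖(2 : ℝ) ^ (-δ)‖ < 1 := by
    rw [Real.norm_of_nonneg (by positivity)]
    exact Real.rpow_lt_one_of_one_lt_of_neg (by norm_num) (by linarith)
  have h1 := summable_pow_mul_geometric_of_norm_lt_one 1 hr
  have h2 := summable_geometric_of_norm_lt_one hr
  refine (h1.add h2).congr fun n => ?_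
  rw [← neg_mul, Real.rpow_mul (by norm_num), Real.rpow_natCast]
  ring

/-- The growth function of the cardinalities of the nets. -/
def netGrowth (a : ℝ) (b m : ℕ) : ℝ := 2 ^ (a * m) * ((m : ℝ) + 1) ^ b

lemma one_le_netGrowth {a : ℝ} (ha : 0 < a) (b m : ℕ) : 1 ≤ netGrowth a b m :=
  one_le_mul_of_one_le_of_one_le (Real.one_le_rpow (by norm_num) (by positivity))
    (one_le_pow₀ (by linarith [(Nat.cast_nonneg m : (0 : ℝ) ≤ m)]))

lemma netGrowth_sub_le {a : ℝ} (b k d : ℕ) :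
    netGrowth a b k ≤ netGrowth a b (k + d) * 2 ^ (-(a * d)) := by
  unfold netGrowth
  have e : (2 : ℝ) ^ (a * (k + d : ℕ)) = 2 ^ (a * k) * 2 ^ (a * d) := by
    rw [← Real.rpow_add (by norm_num)]; push_cast; ring_nf
  rw [e, Real.rpow_neg (by norm_num)]
  have : (2 : ℝ) ^ (a * k) * 2 ^ (a * d) * (((k + d : ℕ) : ℝ) + 1) ^ b * (2 ^ (a * d))⁻¹ =
      2 ^ (a * k) * (((k + d : ℕ) : ℝ) + 1) ^ b := by
    field_simp
  rw [this]
  gcongr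
  omega

lemma netGrowth_add_le {a : ℝ} (b m d : ℕ) :
    netGrowth a b (m + d) ≤ netGrowth a b m * 2 ^ ((a + b) * d) := by
  unfold netGrowth
  have e : (2 : ℝ) ^ (a * (m + d : ℕ)) = 2 ^ (a * m) * 2 ^ (a * d) := by
    rw [← Real.rpow_add (by norm_num)]; push_cast; ring_nf
  have e2 : (2 : ℝ) ^ ((a + b) * d) = 2 ^ (a * d) * (2 ^ d) ^ b := by
    rw [← pow_mul, ← Real.rpow_natCast, ← Real.rpow_add (by norm_num)]; push_cast; ring_nf
  have h1 : ((d : ℝ) + 1) ≤ 2 ^ d := by exact_mod_cast Nat.lt_two_pow_self (n := d)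
  have h2 : (((m + d : ℕ) : ℝ) + 1) ≤ ((m : ℝ) + 1) * 2 ^ d := by
    push_cast
    have : (0 : ℝ) ≤ m := by positivity
    have : (0 : ℝ) ≤ d := by positivity
    nlinarith
  have h3 : (((m + d : ℕ) : ℝ) + 1) ^ b ≤ (((m : ℝ) + 1) * 2 ^ d) ^ b := by gcongr
  rw [e, e2]
  rw [mul_pow] at h3
  calc _ ≤ (2 : ℝ) ^ (a * m) * 2 ^ (a * d) * ((↑m + 1) ^ b * (2 ^ d) ^ b) := by gcongr
    _ = _ := by ring

lemma log_two_rpow_neg_le {c : ℝ} (hc : 0 ≤ c) : -Real.log (2 ^ (-c)) ≤ c := by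
  rw [Real.log_rpow (by norm_num)]
  have : Real.log 2 ≤ 1 := by linarith [Real.log_two_lt_d9]
  nlinarith

lemma log_choose_coarse_le {D M a β δ : ℝ} (hD : 0 < D) (hM : 0 < M) (hβ : 0 < β)
    (hδa : δ ≤ a) (hδ1 : δ ≤ 1) {N l d : ℕ} (hN : N ≤ D * (M * 2 ^ (-(a * d))))
    (hl : l ≤ 2 * (M * 2 ^ (β * d))) :
    Real.log ((N + l).choose l) ≤
      M * ((D * (β + 2) + 2) * (((d : ℝ) + 1) * 2 ^ (-(δ * d)))) := by
  have h0 : (N + l).choose l = (N + l).choose N := by rw [Nat.choose_symm_add]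
  set x : ℝ := 2 ^ (-((β + 1) * d)) with hx
  have hd : (0 : ℝ) ≤ d := by positivity
  have h1 := log_choose_le (N + l) N (x := x) (by positivity) (by omega)
  have h2 : -Real.log x ≤ (β + 1) * d := log_two_rpow_neg_le (by positivity)
  have h3 : x ≤ 1 := Real.rpow_le_one_of_one_le_of_nonpos (by norm_num) (by
    have : 0 ≤ (β + 1) * d := by positivity
    linarith)
  have h4 : (l : ℝ) * x ≤ 2 * (M * 2 ^ (-(d : ℝ))) := by
    have := mul_le_mul_of_nonneg_right hl (by positivity : 0 ≤ x)
    refine this.trans (le_of_eq ?_)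
    rw [hx, mul_assoc, mul_assoc, ← Real.rpow_add (by norm_num)]
    ring_nf
  have h5 : (2 : ℝ) ^ (-(d : ℝ)) ≤ 2 ^ (-(δ * d)) :=
    Real.rpow_le_rpow_of_exponent_le (by norm_num) (by nlinarith)
  have h6 : (2 : ℝ) ^ (-(a * d)) ≤ 2 ^ (-(δ * d)) :=
    Real.rpow_le_rpow_of_exponent_le (by norm_num) (by nlinarith)
  have h7 : (N : ℝ) ≤ D * (M * 2 ^ (-(δ * d))) := hN.trans (by gcongr)
  have h8 : (N : ℝ) * x ≤ N := mul_le_of_le_one_right (by positivity) h3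
  have h9 : (N : ℝ) * -Real.log x ≤ N * ((β + 1) * d) := by gcongr
  have h10 : (l : ℝ) * x ≤ 2 * (M * 2 ^ (-(δ * d))) := h4.trans (by gcongr)
  rw [h0]
  push_cast at h1
  set e : ℝ := 2 ^ (-(δ * d))
  have he : 0 ≤ M * e := by positivity
  have h11 : (N : ℝ) * (1 + (β + 1) * d) ≤ D * (M * e) * (1 + (β + 1) * d) := by gcongr
  have h12 : D * (M * e) * (1 + (β + 1) * d) ≤ D * (M * e) * ((β + 2) * (d + 1)) := by
    gcongr; nlinarith
  have h13 : 2 * (M * e) ≤ 2 * (M * e) * (d + 1) := by nlinarith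
  nlinarith

lemma log_choose_fine_le {D M s β δ : ℝ} (hD : 0 < D) (hM : 0 < M) (hs : 0 < s)
    (hδβ : δ ≤ β) (hδ1 : δ ≤ 1) {N l d : ℕ} (hN : N ≤ D * (M * 2 ^ (s * d)))
    (hl : l ≤ 2 * (M * 2 ^ (-(β * d)))) :
    Real.log ((N + l).choose l) ≤
      M * ((D + 2 * (s + 2)) * (((d : ℝ) + 1) * 2 ^ (-(δ * d)))) := by
  set x : ℝ := 2 ^ (-((s + 1) * d)) with hx
  have hd : (0 : ℝ) ≤ d := by positivity
  have h1 := log_choose_le (N + l) l (x := x) (by positivity) (by omega)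
  have h2 : -Real.log x ≤ (s + 1) * d := log_two_rpow_neg_le (by positivity)
  have h3 : x ≤ 1 := Real.rpow_le_one_of_one_le_of_nonpos (by norm_num) (by
    have : 0 ≤ (s + 1) * d := by positivity
    linarith)
  have h4 : (N : ℝ) * x ≤ D * (M * 2 ^ (-(d : ℝ))) := by
    have := mul_le_mul_of_nonneg_right hN (by positivity : 0 ≤ x)
    refine this.trans (le_of_eq ?_)
    rw [hx, mul_assoc, mul_assoc, ← Real.rpow_add (by norm_num)]
    ring_nf
  have h5 : (2 : ℝ) ^ (-(d : ℝ)) ≤ 2 ^ (-(δ * d)) :=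
    Real.rpow_le_rpow_of_exponent_le (by norm_num) (by nlinarith)
  have h6 : (2 : ℝ) ^ (-(β * d)) ≤ 2 ^ (-(δ * d)) :=
    Real.rpow_le_rpow_of_exponent_le (by norm_num) (by nlinarith)
  have h7 : (l : ℝ) ≤ 2 * (M * 2 ^ (-(δ * d))) := hl.trans (by gcongr)
  have h8 : (l : ℝ) * x ≤ l := mul_le_of_le_one_right (by positivity) h3
  have h9 : (l : ℝ) * -Real.log x ≤ l * ((s + 1) * d) := by gcongr
  have h10 : (N : ℝ) * x ≤ D * (M * 2 ^ (-(δ * d))) := h4.trans (by gcongr)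
  push_cast at h1
  set e : ℝ := 2 ^ (-(δ * d))
  have he : 0 ≤ M * e := by positivity
  have h11 : (l : ℝ) * (1 + (s + 1) * d) ≤ 2 * (M * e) * (1 + (s + 1) * d) := by gcongr
  have h12 : 2 * (M * e) * (1 + (s + 1) * d) ≤ 2 * (M * e) * ((s + 2) * (d + 1)) := by
    gcongr; nlinarith
  have h13 : D * (M * e) ≤ D * (M * e) * (d + 1) := by
    have : 0 ≤ D * (M * e) := by positivity
    nlinarith
  nlinarith

/-- Choice of the sample sizes `l k` at the scales `k < K`. -/
lemma exists_sample_sizes {a D κ r : ℝ} (ha : 0 < a) (b : ℕ) (hD : 0 < D) (hκ : 0 < κ) (hr : 0 < r)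
    (N : ℕ → ℕ) (hN : ∀ k, (N k : ℝ) ≤ D * netGrowth a b k) :
    ∃ A B : ℝ, 0 < A ∧ 0 < B ∧ ∀ m : ℕ, ∃ (K : ℕ) (l : ℕ → ℕ), (∀ k < K, 1 ≤ l k) ∧
      ∑ k ∈ Finset.range K, Real.log ((N k + l k).choose (l k)) ≤ A * netGrowth a b m ∧
      ∑ k ∈ Finset.range K, (2 : ℝ) ^ (-(κ * k)) * (l k : ℝ) ^ (-r) ≤
        B * (2 ^ (-(κ * m)) * netGrowth a b m ^ (-r)) ∧
      (2 : ℝ) ^ (-(κ * K)) ≤ 2 ^ (-(κ * m)) * netGrowth a b m ^ (-r) := by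
  set β : ℝ := 3 * κ / (2 * r) with hβ
  set β' : ℝ := κ / (2 * r) with hβ'
  have hβpos : 0 < β := by positivity
  have hβ'pos : 0 < β' := by positivity
  set s : ℝ := a + b with hs
  have hspos : 0 < s := by positivity
  set δ : ℝ := min a (min β' 1) with hδ
  have hδpos : 0 < δ := by positivity
  have hδa : δ ≤ a := min_le_left _ _
  have hδβ : δ ≤ β' := (min_le_right _ _).trans (min_le_left _ _)
  have hδ1 : δ ≤ 1 := (min_le_right _ _).trans (min_le_right _ _)
  set f : ℕ → ℝ := fun n => ((n : ℝ) + 1) * 2 ^ (-(δ * n)) with hf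
  set g : ℕ → ℝ := fun n => ((n : ℝ) + 1) * 2 ^ (-(κ / 2 * n)) with hg
  have hfs : Summable f := summable_mul_two_rpow_neg hδpos
  have hgs : Summable g := summable_mul_two_rpow_neg (by positivity)
  have hf0 : ∀ n, 0 ≤ f n := fun n => by positivity
  have hg0 : ∀ n, 0 ≤ g n := fun n => by positivity
  set A0 : ℝ := (D * (β + 2) + 2) + (D + 2 * (s + 2)) with hA0
  have hA0pos : 0 < A0 := by positivity
  refine ⟨A0 * (2 * ∑' n, f n) + 1, 2 * ∑' n, g n + 1, ?_, ?_, fun m => ?_⟩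
  · have : 0 ≤ ∑' n, f n := tsum_nonneg hf0
    positivity
  · have : 0 ≤ ∑' n, g n := tsum_nonneg hg0
    positivity
  set M := netGrowth a b m with hM
  have hM1 : 1 ≤ M := one_le_netGrowth ha b m
  have hMpos : 0 < M := by linarith
  have hex : ∃ J : ℕ, M < 2 ^ (β' * J) := by
    obtain ⟨J, hJ⟩ := pow_unbounded_of_one_lt M
      (Real.one_lt_rpow (by norm_num : (1 : ℝ) < 2) hβ'pos)
    exact ⟨J, by rwa [Real.rpow_mul (by norm_num), Real.rpow_natCast]⟩
  classical
  set J := Nat.find hex with hJ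
  have hJ1 : M < 2 ^ (β' * J) := Nat.find_spec hex
  have hJ2 : ∀ d < J, 2 ^ (β' * d) ≤ M := fun d hd => not_lt.1 (Nat.find_min hex hd)
  set lam : ℕ → ℝ := fun k => if k ≤ m then M * 2 ^ (β * (m - k : ℕ)) else
    M * 2 ^ (-(β' * (k - m : ℕ))) with hlam
  have hlam1 : ∀ k < m + J, 1 ≤ lam k := by
    intro k hk
    simp only [hlam]
    split_ifs with h
    · exact one_le_mul_of_one_le_of_one_le hM1 (Real.one_le_rpow (by norm_num) (by positivity))
    · rw [Real.rpow_neg (by norm_num), ← div_eq_mul_inv, one_le_div (by positivity)]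
      exact hJ2 _ (by omega)
  have hl2 : ∀ k < m + J, (⌈lam k⌉₊ : ℝ) ≤ 2 * lam k := fun k hk => by
    have := Nat.ceil_lt_add_one (by linarith [hlam1 k hk] : 0 ≤ lam k)
    linarith [hlam1 k hk]
  refine ⟨m + J, fun k => ⌈lam k⌉₊, fun k hk => ?_, ?_, ?_, ?_⟩
  · exact Nat.one_le_iff_ne_zero.2 (Nat.ceil_pos.2 (by linarith [hlam1 k hk])).ne'
  · have hterm : ∀ k ∈ Finset.range (m + J),
        Real.log ((N k + ⌈lam k⌉₊).choose ⌈lam k⌉₊) ≤ M * A0 * f (Nat.dist k m) := by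
      intro k hk
      have hk' := Finset.mem_range.1 hk
      have hl := hl2 k hk'
      have hNk := hN k
      rcases le_or_gt k m with h | h
      · obtain ⟨d, rfl⟩ := Nat.exists_eq_add_of_le h
        have hdd : Nat.dist k (k + d) = d := by rw [Nat.dist_eq_sub_of_le h]; omega
        simp only [hlam, if_pos h, Nat.add_sub_cancel_left] at hl ⊢
        rw [hdd]
        refine (log_choose_coarse_le hD hMpos hβpos hδa hδ1
          (hNk.trans (mul_le_mul_of_nonneg_left (netGrowth_sub_le b k d) hD.le)) hl).trans ?_
        rw [mul_assoc]
        have := hf0 d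
        gcongr
        have : 0 ≤ D + 2 * (s + 2) := by positivity
        linarith
      · obtain ⟨d, rfl⟩ := Nat.exists_eq_add_of_le h.le
        have hdd : Nat.dist (m + d) m = d := by rw [Nat.dist_eq_sub_of_le_right h.le]; omega
        simp only [hlam, if_neg (not_le.2 h), Nat.add_sub_cancel_left] at hl ⊢
        rw [hdd]
        refine (log_choose_fine_le hD hMpos hspos hδβ hδ1
          (hNk.trans (mul_le_mul_of_nonneg_left (netGrowth_add_le b m d) hD.le)) hl).trans ?_
        rw [mul_assoc]
        have := hf0 d
        gcongr
        have : 0 ≤ D * (β + 2) + 2 := by positivity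
        linarith
    refine (Finset.sum_le_sum hterm).trans ?_
    rw [← Finset.mul_sum]
    have := mul_le_mul_of_nonneg_left (sum_range_dist_le hf0 hfs m (m + J))
      (by positivity : 0 ≤ M * A0)
    nlinarith
  · have hterm : ∀ k ∈ Finset.range (m + J),
        (2 : ℝ) ^ (-(κ * k)) * (⌈lam k⌉₊ : ℝ) ^ (-r) ≤
          (2 ^ (-(κ * m)) * M ^ (-r)) * g (Nat.dist k m) := by
      intro k hk
      have hk' := Finset.mem_range.1 hk
      have h1 : (⌈lam k⌉₊ : ℝ) ^ (-r) ≤ lam k ^ (-r) :=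
        Real.rpow_le_rpow_of_nonpos (by linarith [hlam1 k hk']) (Nat.le_ceil _) (by linarith)
      have h2 : (2 : ℝ) ^ (-(κ * k)) * lam k ^ (-r) =
          (2 ^ (-(κ * m)) * M ^ (-r)) * 2 ^ (-(κ / 2 * Nat.dist k m)) := by
        have hre : ∀ e : ℝ, (M * 2 ^ e) ^ (-r) = M ^ (-r) * 2 ^ (-(r * e)) := fun e => by
          rw [Real.mul_rpow hMpos.le (by positivity), ← Real.rpow_mul (by norm_num)]
          ring_nf
        rcases le_or_gt k m with h | h
        · obtain ⟨d, rfl⟩ := Nat.exists_eq_add_of_le h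
          have hdd : Nat.dist k (k + d) = d := by rw [Nat.dist_eq_sub_of_le h]; omega
          simp only [hlam, if_pos h, Nat.add_sub_cancel_left]
          rw [hdd, hre, mul_left_comm, mul_comm ((2 : ℝ) ^ _) (M ^ (-r)), mul_assoc,
            ← Real.rpow_add (by norm_num), ← Real.rpow_add (by norm_num)]
          congr 2
          rw [hβ]; push_cast; field_simp; ring
        · obtain ⟨d, rfl⟩ := Nat.exists_eq_add_of_le h.le
          have hdd : Nat.dist (m + d) m = d := by rw [Nat.dist_eq_sub_of_le_right h.le]; omega
          simp only [hlam, if_neg (not_le.2 h), Nat.add_sub_cancel_left]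
          rw [hdd, hre, mul_left_comm, mul_comm ((2 : ℝ) ^ _) (M ^ (-r)), mul_assoc,
            ← Real.rpow_add (by norm_num), ← Real.rpow_add (by norm_num)]
          congr 2
          rw [hβ']; push_cast; field_simp; ring
      calc _ ≤ (2 : ℝ) ^ (-(κ * k)) * lam k ^ (-r) := by gcongr
        _ = _ := h2
        _ ≤ _ := by
          gcongr
          simp only [hg]
          refine le_mul_of_one_le_left (by positivity) ?_
          have : (0 : ℝ) ≤ (Nat.dist k m : ℕ) := by positivity
          linarith
    refine (Finset.sum_le_sum hterm).trans ?_
    rw [← Finset.mul_sum]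
    have hpos : 0 ≤ (2 : ℝ) ^ (-(κ * m)) * M ^ (-r) := by positivity
    have := mul_le_mul_of_nonneg_left (sum_range_dist_le hg0 hgs m (m + J)) hpos
    linarith
  · have h1 : M ^ r ≤ 2 ^ (κ / 2 * J) := by
      have := Real.rpow_le_rpow hMpos.le hJ1.le hr.le
      rw [← Real.rpow_mul (by norm_num)] at this
      refine this.trans (le_of_eq ?_)
      congr 1
      rw [hβ']; field_simp
    have h2 : (2 : ℝ) ^ (-(κ * (m + J : ℕ))) = 2 ^ (-(κ * m)) * 2 ^ (-(κ * J)) := by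
      rw [← Real.rpow_add (by norm_num)]; push_cast; ring_nf
    rw [h2]
    gcongr
    rw [Real.rpow_neg hMpos.le, Real.rpow_neg (by norm_num)]
    gcongr
    refine h1.trans (Real.rpow_le_rpow_of_exponent_le (by norm_num) ?_)
    gcongr
    linarith

lemma Convex.sum_smul_mem_of_neg_mem {E ι : Type} [AddCommGroup E] [Module ℝ E] {S : Set E}
    (hS : Convex ℝ S) (h0 : (0 : E) ∈ S) (hneg : ∀ y ∈ S, -y ∈ S) (t : Finset ι) (w : ι → ℝ)
    (z : ι → E) (hw : ∑ i ∈ t, |w i| ≤ 1) (hz : ∀ i ∈ t, z i ∈ S) : ∑ i ∈ t, w i • z i ∈ S := by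
  rcases (Finset.sum_nonneg fun i _ => abs_nonneg (w i) : 0 ≤ ∑ i ∈ t, |w i|).eq_or_lt with h | h
  · have : ∀ i ∈ t, |w i| = 0 := (Finset.sum_eq_zero_iff_of_nonneg fun i _ => abs_nonneg _).1 h.symm
    rw [Finset.sum_eq_zero fun i hi => by rw [abs_eq_zero.1 (this i hi), zero_smul]]
    exact h0
  · set z' : ι → E := fun i => if 0 ≤ w i then z i else -z i with hz'
    have e : ∑ i ∈ t, w i • z i = (∑ i ∈ t, |w i|) • t.centerMass (fun i => |w i|) z' := by
      rw [Finset.centerMass, smul_smul, mul_inv_cancel₀ h.ne', one_smul]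
      refine Finset.sum_congr rfl fun i _ => ?_
      simp only [hz']
      split_ifs with hi
      · rw [abs_of_nonneg hi]
      · rw [abs_of_neg (not_le.1 hi), smul_neg, neg_smul, neg_neg]
    rw [e]
    refine hS.smul_mem_of_zero_mem h0 (hS.centerMass_mem (fun i _ => abs_nonneg _) h
      fun i hi => ?_) ⟨h.le, hw⟩
    simp only [hz']
    split_ifs
    · exact hz i hi
    · exact hneg _ (hz i hi)

lemma ellOne_sum_abs_le {T : Type} (x : ellOne T) (t : Finset T) : ∑ s ∈ t, |x s| ≤ ‖x‖ := by
  have := lp.sum_rpow_le_norm_rpow (p := 1) (by simp) x t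
  simpa using this

lemma exists_finset_norm_sub_lt {T Y : Type} [DecidableEq T] [NormedAddCommGroup Y]
    [NormedSpace ℝ Y] (V : ellOne T →L[ℝ] Y) (x : ellOne T) {η : ℝ} (hη : 0 < η) :
    ∃ t : Finset T, ‖V x - ∑ s ∈ t, x s • V (lp.single 1 s 1)‖ < η := by
  have h1 := (lp.hasSum_single (p := 1) (by simp) x).mapL V
  obtain ⟨t, ht⟩ := (Metric.tendsto_atTop.1 h1) η hη
  refine ⟨t, ?_⟩
  have := ht t le_rfl
  rw [dist_comm, dist_eq_norm] at this
  rwa [Finset.sum_congr rfl fun s _ => ?_] at this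
  simp only
  rw [← map_smul, ← lp.single_smul, smul_eq_mul, mul_one]

/-- A finite approximation scheme for the extreme points yields entropy estimates. -/
lemma entropyNumber_le_of_scheme {T Y : Type} [DecidableEq T] [NormedAddCommGroup Y]
    [NormedSpace ℝ Y] (V : ellOne T →L[ℝ] Y) {C r κ a D B₀ : ℝ} {b : ℕ} (hC : 0 < C) (hr : 0 < r)
    (hκ : 0 < κ) (ha : 0 < a) (hD : 0 < D) (hB₀ : 0 < B₀) (hY : MaureyApprox Y C r)
    (u : ℕ → T → Y) (net : ℕ → Finset T)
    (hu0 : ∀ s, u 0 s = V (lp.single 1 s 1))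
    (hu : ∀ k s, ‖u k s‖ ≤ B₀ * 2 ^ (-(κ * k)))
    (hstep : ∀ k s, u k s - u (k + 1) s = 0 ∨
      ∃ v ∈ net k, ∃ θ : ℝ, 0 ≤ θ ∧ θ ≤ 1 ∧ u k s - u (k + 1) s = θ • u k v)
    (hcard : ∀ k, ((net k).card : ℝ) ≤ D * netGrowth a b k) :
    ∃ A B : ℝ, 0 < A ∧ 0 < B ∧ ∀ m n : ℕ, A * netGrowth a b m + 1 ≤ n →
      entropyNumber n V ≤ B * (2 ^ (-(κ * m)) * netGrowth a b m ^ (-r)) := by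
  classical
  obtain ⟨A, B, hA, hB, hAB⟩ := exists_sample_sizes (a := a) (D := 2 * D) ha b (by positivity) hκ hr
    (fun k => 2 * (net k).card) (fun k => by push_cast; linarith [hcard k])
  refine ⟨2 * A, C * (B₀ * B) + B₀ + 1, by positivity, by positivity, fun m n hn => ?_⟩
  obtain ⟨K, l, hl, hbits, herr, hrem⟩ := hAB m
  set Q : ℝ := 2 ^ (-(κ * m)) * netGrowth a b m ^ (-r) with hQ
  have hM := one_le_netGrowth ha b m
  have hQpos : 0 < Q := by positivity
  set ρ : ℕ → ℝ := fun k => B₀ * 2 ^ (-(κ * k)) with hρ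
  have hρpos : ∀ k, 0 < ρ k := fun k => by positivity
  set U : ℕ → Finset Y := fun k => (net k).image fun v => (ρ k)⁻¹ • u k v with hU
  set P : ℕ → Finset Y := fun k => insert 0 (U k ∪ (U k).image Neg.neg) with hP
  have hUn : ∀ k, ∀ y ∈ U k, ‖y‖ ≤ 1 := by
    intro k y hy
    obtain ⟨v, -, rfl⟩ := Finset.mem_image.1 hy
    rw [norm_smul, norm_inv, Real.norm_of_nonneg (hρpos k).le, inv_mul_le_one₀ (hρpos k)]
    exact hu k v
  have hPn : ∀ k, ∀ y ∈ P k, ‖y‖ ≤ 1 := by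
    intro k y hy
    rcases Finset.mem_insert.1 hy with rfl | hy
    · simp
    · rcases Finset.mem_union.1 hy with hy | hy
      · exact hUn k y hy
      · obtain ⟨z, hz, rfl⟩ := Finset.mem_image.1 hy
        rw [norm_neg]
        exact hUn k z hz
  have hPc : ∀ k, (P k).card ≤ 2 * (net k).card + 1 := by
    intro k
    have h1 : (U k).card ≤ (net k).card := Finset.card_image_le
    have h2 : ((U k).image Neg.neg).card ≤ (U k).card := Finset.card_image_le
    have h3 := Finset.card_union_le (U k) ((U k).image Neg.neg)
    have h4 := Finset.card_insert_le (0 : Y) (U k ∪ (U k).image Neg.neg)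
    simp only [hP]
    omega
  have hPneg : ∀ k, ∀ y ∈ convexHull ℝ (P k : Set Y), -y ∈ convexHull ℝ (P k : Set Y) := by
    intro k y hy
    rw [← Set.mem_neg, ← convexHull_neg]
    refine convexHull_mono (fun z hz => ?_) hy
    simp only [hP, Finset.coe_insert, Finset.coe_union, Finset.coe_image, Set.image_neg_eq_neg,
      Set.mem_neg, Set.mem_insert_iff, Set.mem_union, neg_eq_zero, neg_neg] at hz ⊢
    tauto
  have hP0 : ∀ k, (0 : Y) ∈ convexHull ℝ (P k : Set Y) := fun k =>
    subset_convexHull ℝ _ (Finset.mem_coe.2 (Finset.mem_insert_self _ _))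
  have hstep' : ∀ k s, (ρ k)⁻¹ • (u k s - u (k + 1) s) ∈ convexHull ℝ (P k : Set Y) := by
    intro k s
    rcases hstep k s with h | ⟨v, hv, θ, hθ0, hθ1, h⟩
    · rw [h, smul_zero]; exact hP0 k
    · rw [h, smul_comm]
      refine (convex_convexHull ℝ _).smul_mem_of_zero_mem (hP0 k) (subset_convexHull ℝ _ ?_)
        ⟨hθ0, hθ1⟩
      exact Finset.mem_coe.2 (Finset.mem_insert_of_mem (Finset.mem_union_left _
        (Finset.mem_image_of_mem _ hv)))
  obtain ⟨F, hF, hFc⟩ := hY.exists_cover_sum P hPn (fun k => 2 * (net k).card) l hPc ρ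
    (fun k => (hρpos k).le) K hl
  refine csInf_le ⟨0, fun e he => he.1.le⟩ ⟨by positivity, F, ?_, fun x hx => ?_⟩
  · have h1 : (F.card : ℝ) ≤ 2 ^ (n - 1) := by
      have hprod : (0 : ℝ) < ∏ k ∈ Finset.range K,
          (((2 * (net k).card + l k).choose (l k) : ℕ) : ℝ) :=
        Finset.prod_pos fun k _ => by exact_mod_cast Nat.choose_pos (by omega)
      have hF' : (F.card : ℝ) ≤ ∏ k ∈ Finset.range K,
          (((2 * (net k).card + l k).choose (l k) : ℕ) : ℝ) := by exact_mod_cast hF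
      refine hF'.trans ?_
      rw [← Real.log_le_log_iff hprod (by positivity), Real.log_pow,
        Real.log_prod (fun k _ => by exact_mod_cast (Nat.choose_pos (by omega)).ne')]
      refine hbits.trans ?_
      have hn1 : 1 ≤ n := by
        have : (1 : ℝ) ≤ n := le_trans (by nlinarith) hn
        exact_mod_cast this
      rw [Nat.cast_sub hn1, Nat.cast_one]
      have := Real.log_two_gt_d9
      have h2 : 2 * A * netGrowth a b m ≤ n - 1 := by linarith
      have h3 : 0 < A * netGrowth a b m := by positivity
      nlinarith
    exact_mod_cast h1
  · obtain ⟨t, ht⟩ := exists_finset_norm_sub_lt V x hQpos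
    set c : ℕ → Y := fun k => ∑ s ∈ t, x s • ((ρ k)⁻¹ • (u k s - u (k + 1) s)) with hc
    have hxt : ∑ s ∈ t, |x s| ≤ 1 := (ellOne_sum_abs_le x t).trans hx
    obtain ⟨y, hy, hyc⟩ := hFc c fun k =>
      (convex_convexHull ℝ _).sum_smul_mem_of_neg_mem (hP0 k) (hPneg k) t _ _ hxt
        fun s _ => hstep' k s
    refine ⟨y, hy, ?_⟩
    have e1 : ∑ s ∈ t, x s • V (lp.single 1 s 1) =
        ∑ k ∈ Finset.range K, ρ k • c k + ∑ s ∈ t, x s • u K s := by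
      have : ∀ k, ρ k • c k = ∑ s ∈ t, x s • (u k s - u (k + 1) s) := by
        intro k
        rw [hc, Finset.smul_sum]
        refine Finset.sum_congr rfl fun s _ => ?_
        rw [smul_comm, smul_smul (ρ k), mul_inv_cancel₀ (hρpos k).ne', one_smul]
      simp_rw [this]
      rw [Finset.sum_comm, ← Finset.sum_add_distrib]
      refine Finset.sum_congr rfl fun s _ => ?_
      rw [← Finset.smul_sum, Finset.sum_range_sub' (fun k => u k s), ← smul_add, sub_add_cancel, hu0]
    have h2 : ‖∑ s ∈ t, x s • u K s‖ ≤ B₀ * Q := by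
      refine (norm_sum_le _ _).trans ?_
      calc ∑ s ∈ t, ‖x s • u K s‖ ≤ ∑ s ∈ t, |x s| * (B₀ * Q) := by
            refine Finset.sum_le_sum fun s _ => ?_
            rw [norm_smul, Real.norm_eq_abs]
            gcongr
            exact (hu K s).trans (by gcongr)
        _ = (∑ s ∈ t, |x s|) * (B₀ * Q) := by rw [Finset.sum_mul]
        _ ≤ 1 * (B₀ * Q) := by gcongr
        _ = _ := one_mul _
    have h3 : C * ∑ k ∈ Finset.range K, ρ k * (l k : ℝ) ^ (-r) ≤ C * (B₀ * B) * Q := by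
      simp only [hρ]
      simp_rw [mul_assoc B₀]
      rw [← Finset.mul_sum, mul_assoc C, mul_assoc B₀]
      gcongr
    have e2 : V x - y = (V x - ∑ s ∈ t, x s • V (lp.single 1 s 1)) +
        ((∑ k ∈ Finset.range K, ρ k • c k - y) + ∑ s ∈ t, x s • u K s) := by
      rw [e1]; abel
    rw [e2]
    have h4 := norm_add_le (V x - ∑ s ∈ t, x s • V (lp.single 1 s 1))
      ((∑ k ∈ Finset.range K, ρ k • c k - y) + ∑ s ∈ t, x s • u K s)
    have h5 := norm_add_le (∑ k ∈ Finset.range K, ρ k • c k - y) (∑ s ∈ t, x s • u K s)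
    linarith

section Tree

variable {T : Type} [PartialOrder T] [OrderBot T]

lemma gen_lt_of_lt (htree : IsTree T) {s t : T} (h : s < t) : gen s < gen t := by
  have hfin : (Set.Iio t).Finite := (htree.1 t).subset Set.Iio_subset_Iic_self
  refine Set.ncard_lt_ncard ⟨Set.Iio_subset_Iio h.le, fun hs => ?_⟩ hfin
  exact lt_irrefl s (hs h)

lemma gen_injOn (htree : IsTree T) (v : T) : Set.InjOn gen (Set.Iic v) := by
  intro a ha b hb hab
  rcases htree.2.1 v a b ha hb with h | h
  · rcases h.eq_or_lt with h | h
    · exact h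
    · exact absurd (gen_lt_of_lt htree h) (by omega)
  · rcases h.eq_or_lt with h | h
    · exact h.symm
    · exact absurd (gen_lt_of_lt htree h) (by omega)

lemma gen_mono (htree : IsTree T) {s t : T} (h : s ≤ t) : gen s ≤ gen t := by
  rcases h.eq_or_lt with rfl | h
  · exact le_rfl
  · exact (gen_lt_of_lt htree h).le

lemma exists_le_gen_eq (htree : IsTree T) (v : T) {j : ℕ} (hj : j ≤ gen v) :
    ∃ r ≤ v, gen r = j := by
  have hfin : (Set.Iio v).Finite := (htree.1 v).subset Set.Iio_subset_Iic_self
  have h1 : gen '' Set.Iic v ⊆ Set.Iic (gen v) := by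
    rintro _ ⟨r, hr, rfl⟩
    exact gen_mono htree hr
  have h2 : (gen '' Set.Iic v).ncard = gen v + 1 := by
    rw [(gen_injOn htree v).ncard_image, ← Set.Iio_insert, Set.ncard_insert_of_notMem (by simp) hfin]
    rfl
  have h3 : (Set.Iic (gen v)).ncard = gen v + 1 := by
    rw [Set.ncard_eq_toFinset_card']
    simp
  have h4 := Set.eq_of_subset_of_ncard_le h1 (by omega) (Set.finite_Iic _)
  have : j ∈ gen '' Set.Iic v := by rw [h4]; exact hj
  obtain ⟨r, hr, hrj⟩ := this
  exact ⟨r, hr, hrj⟩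

lemma eq_bot_of_gen_eq_zero (htree : IsTree T) {t : T} (h : gen t = 0) : t = ⊥ := by
  by_contra hne
  have := gen_lt_of_lt htree (bot_lt_iff_ne_bot.2 hne)
  omega

lemma finite_gen_eq (htree : IsTree T) (n : ℕ) : {t : T | gen t = n}.Finite := by
  induction n with
  | zero =>
    exact (Set.finite_singleton (⊥ : T)).subset fun t ht => eq_bot_of_gen_eq_zero htree ht
  | succ n ih =>
    refine (ih.biUnion fun s _ => htree.2.2 s).subset fun t ht => ?_
    have ht' : gen t = n + 1 := ht
    obtain ⟨r, hr, hrn⟩ := exists_le_gen_eq htree t (j := n) (by omega)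
    have hne : r ≠ t := fun h => by subst h; omega
    refine Set.mem_biUnion (x := r) hrn ⟨lt_of_le_of_ne hr hne, fun z hz hzt => ?_⟩
    have := gen_lt_of_lt htree hz
    have := gen_lt_of_lt htree hzt
    omega

open Classical in
/-- The part of the image of the unit vector at `s` living on those ancestors of `s` which are not
separated from `s` by the set `S`. -/
def branchFun (α σ : T → ℝ) (S : Set T) (s t : T) : ℝ :=
  if t ≤ s ∧ ∀ v ∈ S, t ≤ v → ¬ v ≤ s then α t * σ s else 0

/-- `branchFun` as an element of `ℓ_q`. -/
def branchVec (htree : IsTree T) (q : ℝ) (α σ : T → ℝ) (S : Set T) (s : T) : ellQ T q :=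
  ⟨branchFun α σ S s, (memℓp_zero ((htree.1 s).subset fun t ht => by
    by_contra h
    exact ht (if_neg fun hh => h hh.1))).of_exponent_ge zero_le⟩

lemma branchVec_apply (htree : IsTree T) (q : ℝ) (α σ : T → ℝ) (S : Set T) (s t : T) :
    branchVec htree q α σ S s t = branchFun α σ S s t := rfl

lemma norm_branchVec_rpow_le (htree : IsTree T) {q : ℝ} (hq : 1 < q) {α σ : T → ℝ}
    (hα : ∀ t, 0 < α t) (hσpos : ∀ t, 0 < σ t) (hσmono : ∀ ⦃t s : T⦄, t ≤ s → σ s ≤ σ t)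
    {w : ℕ → ℝ} (hw0 : ∀ j, 0 ≤ w j) (hw : ∀ t, (α t * σ t) ^ q ≤ w (gen t)) {L : Set ℕ} {ε : ℝ}
    (hε : 0 ≤ ε)
    (hL : ∀ i n : ℕ, i ≤ n → (∀ j, i ≤ j → j ≤ n → j ∉ L) → ∑ j ∈ Finset.Ico i (n + 1), w j ≤ ε)
    (s : T) : ‖branchVec htree q α σ {v | gen v ∈ L} s‖ ^ q ≤ ε := by
  classical
  set X : Set T := {t | t ≤ s ∧ ∀ v ∈ {v | gen v ∈ L}, t ≤ v → ¬ v ≤ s} with hX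
  have hXfin : X.Finite := (htree.1 s).subset fun t ht => ht.1
  have hsum : ‖branchVec htree q α σ {v | gen v ∈ L} s‖ ^ q =
      ∑ t ∈ hXfin.toFinset, (α t * σ s) ^ q := by
    refine (ellQ_hasSum hq _).unique ?_
    have : ∀ t ∉ hXfin.toFinset,
        |branchVec htree q α σ {v | gen v ∈ L} s t| ^ q = 0 := by
      intro t ht
      rw [branchVec_apply, branchFun, if_neg (c := t ≤ s ∧ ∀ v ∈ {v | gen v ∈ L}, t ≤ v → ¬ v ≤ s)
        fun h => ht (hXfin.mem_toFinset.2 h), abs_zero, Real.zero_rpow (by linarith)]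
    have hs := hasSum_sum_of_ne_finset_zero (L := SummationFilter.unconditional T) this
    rw [Finset.sum_congr rfl (g := fun t => (α t * σ s) ^ q) fun t ht => ?_] at hs
    · exact hs
    rw [branchVec_apply, branchFun, if_pos (c := t ≤ s ∧ ∀ v ∈ {v | gen v ∈ L}, t ≤ v → ¬ v ≤ s)
      (hXfin.mem_toFinset.1 ht), abs_of_pos (mul_pos (hα t) (hσpos s))]
  rw [hsum]
  rcases X.eq_empty_or_nonempty with h | h
  · have : hXfin.toFinset = ∅ := by simpa using h
    rw [this]
    simpa using hε
  · obtain ⟨t₀, ht₀, hmin⟩ := Set.exists_min_image X gen hXfin h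
    have h1 : ∑ t ∈ hXfin.toFinset, (α t * σ s) ^ q ≤ ∑ t ∈ hXfin.toFinset, w (gen t) := by
      refine Finset.sum_le_sum fun t ht => le_trans ?_ (hw t)
      have := hσmono (hXfin.mem_toFinset.1 ht).1
      have := (hα t).le
      have := (hσpos s).le
      gcongr
    have hinj : Set.InjOn gen (hXfin.toFinset : Set T) := fun a ha b hb =>
      gen_injOn htree s (hXfin.mem_toFinset.1 ha).1 (hXfin.mem_toFinset.1 hb).1
    rw [← Finset.sum_image (f := w) hinj] at h1
    refine h1.trans (le_trans (Finset.sum_le_sum_of_subset_of_nonneg (fun j hj => ?_)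
      fun _ _ _ => hw0 _) (hL (gen t₀) (gen s) (gen_mono htree ht₀.1) fun j hj1 hj2 hjL => ?_))
    · obtain ⟨t, ht, rfl⟩ := Finset.mem_image.1 hj
      have htX := hXfin.mem_toFinset.1 ht
      exact Finset.mem_Ico.2 ⟨hmin t htX, Nat.lt_succ_of_le (gen_mono htree htX.1)⟩
    · obtain ⟨r, hr, rfl⟩ := exists_le_gen_eq htree s hj2
      have htr : t₀ ≤ r := by
        rcases htree.2.1 s t₀ r ht₀.1 hr with h | h
        · exact h
        · rcases h.eq_or_lt with h | h
          · exact h.ge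
          · exact absurd (gen_lt_of_lt htree h) (by omega)
      exact ht₀.2 r hjL htr hr

lemma branchVec_sub (htree : IsTree T) (q : ℝ) {α σ : T → ℝ} (hσpos : ∀ t, 0 < σ t)
    (hσmono : ∀ ⦃t s : T⦄, t ≤ s → σ s ≤ σ t) {S S' : Set T} (hS : S ⊆ S') (s : T) :
    branchVec htree q α σ S s - branchVec htree q α σ S' s = 0 ∨
      ∃ v ∈ S', ∃ θ : ℝ, 0 ≤ θ ∧ θ ≤ 1 ∧
        branchVec htree q α σ S s - branchVec htree q α σ S' s =
          θ • branchVec htree q α σ S v := by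
  classical
  by_cases hne : ∃ v ∈ S', v ≤ s
  · right
    have hfin : {v | v ∈ S' ∧ v ≤ s}.Finite := (htree.1 s).subset fun v hv => hv.2
    obtain ⟨v, ⟨hvS, hvs⟩, hmax⟩ := Set.exists_max_image {v | v ∈ S' ∧ v ≤ s} gen hfin hne
    have hle : ∀ z ∈ S', z ≤ s → z ≤ v := by
      intro z hz hzs
      rcases htree.2.1 s z v hzs hvs with h | h
      · exact h
      · rcases h.eq_or_lt with h | h
        · exact h.ge
        · exact absurd (gen_lt_of_lt htree h) (not_lt.2 (hmax z ⟨hz, hzs⟩))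
    refine ⟨v, hvS, σ s / σ v, div_nonneg (hσpos s).le (hσpos v).le,
      (div_le_one (hσpos v)).2 (hσmono hvs), ?_⟩
    ext t
    simp only [lp.coeFn_sub, lp.coeFn_smul, Pi.sub_apply, Pi.smul_apply, smul_eq_mul,
      branchVec_apply, branchFun]
    by_cases htv : t ≤ v
    · rw [if_neg (c := t ≤ s ∧ ∀ v ∈ S', t ≤ v → ¬ v ≤ s) fun h => h.2 v hvS htv hvs]
      have hiff : (t ≤ s ∧ ∀ v ∈ S, t ≤ v → ¬ v ≤ s) ↔ (t ≤ v ∧ ∀ z ∈ S, t ≤ z → ¬ z ≤ v) :=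
        ⟨fun h => ⟨htv, fun z hz htz hzv => h.2 z hz htz (hzv.trans hvs)⟩,
          fun h => ⟨htv.trans hvs, fun z hz htz hzs => h.2 z hz htz (hle z (hS hz) hzs)⟩⟩
      simp only [hiff]
      split_ifs
      · have := (hσpos v).ne'
        field_simp
        ring
      · simp
    · rw [if_neg (c := t ≤ v ∧ ∀ z ∈ S, t ≤ z → ¬ z ≤ v) fun h => htv h.1]
      have hiff : (t ≤ s ∧ ∀ v ∈ S, t ≤ v → ¬ v ≤ s) ↔ (t ≤ s ∧ ∀ v ∈ S', t ≤ v → ¬ v ≤ s) :=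
        ⟨fun h => ⟨h.1, fun z hz htz hzs => htv (htz.trans (hle z hz hzs))⟩,
          fun h => ⟨h.1, fun z hz => h.2 z (hS hz)⟩⟩
      simp only [hiff]
      simp
  · left
    push Not at hne
    ext t
    simp only [lp.coeFn_sub, Pi.sub_apply, branchVec_apply, branchFun, lp.coeFn_zero, Pi.zero_apply]
    have hiff : (t ≤ s ∧ ∀ v ∈ S, t ≤ v → ¬ v ≤ s) ↔ (t ≤ s ∧ ∀ v ∈ S', t ≤ v → ¬ v ≤ s) :=
      ⟨fun h => ⟨h.1, fun z hz _ => hne z hz⟩, fun h => ⟨h.1, fun z hz => h.2 z (hS hz)⟩⟩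
    simp only [hiff]
    simp

lemma branchVec_empty [DecidableEq T] (htree : IsTree T) {q : ℝ} [Fact (1 ≤ ENNReal.ofReal q)]
    {α σ : T → ℝ} (V : ellOne T →L[ℝ] ellQ T q)
    (hV : ∀ (x : ellOne T) (t : T), (V x : ∀ _ : T, ℝ) t =
      α t * ∑' s : {s : T // t ≤ s}, σ s.1 * (x : ∀ _ : T, ℝ) s.1) (s : T) :
    branchVec htree q α σ ∅ s = V (lp.single 1 s 1) := by
  ext t
  rw [hV, branchVec_apply, branchFun]
  by_cases h : t ≤ s
  · rw [if_pos ⟨h, by simp⟩, tsum_eq_single (⟨s, h⟩ : {s : T // t ≤ s})]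
    · simp
    · intro z hz
      rw [lp.single_apply_ne _ _ _ fun h => hz (Subtype.ext h), mul_zero]
  · rw [if_neg fun hh => h hh.1]
    have : ∀ z : {s : T // t ≤ s}, σ z.1 * (lp.single (E := fun _ : T => ℝ) 1 s (1 : ℝ)) z.1 = 0 := by
      intro z
      rw [lp.single_apply_ne, mul_zero]
      rintro rfl
      exact h z.2
    simp only [this, tsum_zero, mul_zero]

end Tree

/-- The decreasing function whose dyadic level crossings define the nets. -/
def decay (γ : ℝ) (j : ℕ) : ℝ := 1 / 2 * ((j : ℝ) + 1) ^ (-(γ - 1))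

/-- The generations at which `decay γ` leaves a dyadic interval of length `2 ^ (-k)`. -/
def levels (γ : ℝ) (k : ℕ) : Set ℕ :=
  {j | ⌊(2 : ℝ) ^ k * decay γ j⌋₊ ≠ ⌊(2 : ℝ) ^ k * decay γ (j + 1)⌋₊}

lemma decay_pos (γ : ℝ) (j : ℕ) : 0 < decay γ j := by
  unfold decay
  positivity

lemma decay_antitone {γ : ℝ} (hγ : 1 < γ) : Antitone (decay γ) := by
  intro i j hij
  have : (i : ℝ) ≤ j := by exact_mod_cast hij
  unfold decay
  have := Real.rpow_le_rpow_of_nonpos (x := (i : ℝ) + 1) (y := (j : ℝ) + 1) (z := -(γ - 1))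
    (by positivity) (by linarith) (by linarith)
  linarith

lemma decay_le {γ : ℝ} (hγ : 1 < γ) (j : ℕ) : decay γ j ≤ 1 / 2 := by
  have := decay_antitone hγ (Nat.zero_le j)
  simpa [decay] using this

lemma levels_zero {γ : ℝ} (hγ : 1 < γ) : levels γ 0 = ∅ := by
  have : ∀ j, ⌊decay γ j⌋₊ = 0 := fun j => by
    rw [Nat.floor_eq_zero]
    linarith [decay_le hγ j]
  ext j
  simp [levels, this]

lemma levels_mono_succ (γ : ℝ) (k : ℕ) : levels γ k ⊆ levels γ (k + 1) := by
  have key : ∀ x : ℝ, ⌊(2 : ℝ) ^ k * x⌋₊ = ⌊(2 : ℝ) ^ (k + 1) * x⌋₊ / 2 := fun x => by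
    rw [← Nat.floor_div_natCast]
    congr 1
    push_cast
    ring
  intro j hj h
  exact hj (by rw [key, key, h])

lemma rpow_neg_le_two_rpow_mul {γ x : ℝ} (hγ : 0 ≤ γ) (hx : 1 ≤ x) :
    x ^ (-γ) ≤ 2 ^ γ * (x + 1) ^ (-γ) := by
  have h1 : (2 * x) ^ (-γ) ≤ (x + 1) ^ (-γ) :=
    Real.rpow_le_rpow_of_nonpos (by positivity) (by linarith) (by linarith)
  rw [Real.mul_rpow (by norm_num) (by linarith), Real.rpow_neg (by norm_num : (0 : ℝ) ≤ 2)] at h1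
  calc x ^ (-γ) = 2 ^ γ * ((2 ^ γ)⁻¹ * x ^ (-γ)) := by field_simp
    _ ≤ _ := by gcongr

lemma rpow_neg_le_decay_sub {γ : ℝ} (hγ : 1 < γ) (j : ℕ) :
    ((j : ℝ) + 1) ^ (-γ) ≤ 2 ^ (γ + 1) / (γ - 1) * (decay γ j - decay γ (j + 1)) := by
  have hg : 0 < γ - 1 := by linarith
  set x : ℝ := (j : ℝ) + 1 with hx
  have hx1 : 1 ≤ x := by simp [hx]
  have hx0 : 0 < x := by linarith
  have hcast : ((j + 1 : ℕ) : ℝ) + 1 = x + 1 := by push_cast; ring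
  simp only [decay, hcast, ← hx]
  have hlog : 1 / (x + 1) ≤ Real.log ((x + 1) / x) := by
    have := Real.one_sub_inv_le_log_of_pos (x := (x + 1) / x) (by positivity)
    refine le_trans (le_of_eq ?_) this
    field_simp
    ring
  have hratio : 1 + (γ - 1) / (x + 1) ≤ ((x + 1) / x) ^ (γ - 1) := by
    rw [Real.rpow_def_of_pos (by positivity)]
    have h1 := Real.add_one_le_exp (Real.log ((x + 1) / x) * (γ - 1))
    have h2 : (γ - 1) / (x + 1) ≤ Real.log ((x + 1) / x) * (γ - 1) := by
      have := mul_le_mul_of_nonneg_right hlog hg.le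
      refine le_trans (le_of_eq ?_) this
      ring
    linarith
  have hmul : x ^ (-(γ - 1)) = ((x + 1) / x) ^ (γ - 1) * (x + 1) ^ (-(γ - 1)) := by
    rw [Real.div_rpow (by positivity) hx0.le, Real.rpow_neg hx0.le, Real.rpow_neg (by positivity)]
    have : (x + 1) ^ (γ - 1) ≠ 0 := by positivity
    field_simp
  have hdiff : (γ - 1) * (x + 1) ^ (-γ) ≤ x ^ (-(γ - 1)) - (x + 1) ^ (-(γ - 1)) := by
    have hpos : 0 < (x + 1) ^ (-(γ - 1)) := by positivity
    have h1 := mul_le_mul_of_nonneg_right hratio hpos.le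
    rw [← hmul] at h1
    have h2 : (x + 1) ^ (-γ) = (x + 1) ^ (-(γ - 1)) / (x + 1) := by
      rw [← Real.rpow_sub_one (by positivity)]
      congr 1
      ring
    rw [h2]
    have : (γ - 1) * ((x + 1) ^ (-(γ - 1)) / (x + 1)) =
      (γ - 1) / (x + 1) * (x + 1) ^ (-(γ - 1)) := by ring
    linarith
  calc x ^ (-γ) ≤ 2 ^ γ * (x + 1) ^ (-γ) :=
        rpow_neg_le_two_rpow_mul (by linarith) hx1
    _ = 2 ^ γ / (γ - 1) * ((γ - 1) * (x + 1) ^ (-γ)) := by field_simp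
    _ ≤ 2 ^ γ / (γ - 1) * (x ^ (-(γ - 1)) - (x + 1) ^ (-(γ - 1))) := by gcongr
    _ = _ := by
      rw [Real.rpow_add_one (by norm_num)]
      ring

lemma sum_rpow_neg_le_of_notMem_levels {γ : ℝ} (hγ : 1 < γ) {k i n : ℕ} (hin : i ≤ n)
    (h : ∀ j, i ≤ j → j ≤ n → j ∉ levels γ k) :
    ∑ j ∈ Finset.Ico i (n + 1), ((j : ℝ) + 1) ^ (-γ) ≤
      2 ^ (γ + 1) / (γ - 1) * ((2 : ℝ) ^ k)⁻¹ := by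
  have hg : 0 < γ - 1 := by linarith
  have hfloor : ∀ d, i + d ≤ n + 1 →
      ⌊(2 : ℝ) ^ k * decay γ i⌋₊ = ⌊(2 : ℝ) ^ k * decay γ (i + d)⌋₊ := by
    intro d
    induction d with
    | zero => simp
    | succ d ih =>
      intro hd
      rw [ih (by omega)]
      exact not_not.1 (h (i + d) (by omega) (by omega))
  have hfl := hfloor (n + 1 - i) (by omega)
  rw [show i + (n + 1 - i) = n + 1 by omega] at hfl
  have h1 := Nat.lt_floor_add_one ((2 : ℝ) ^ k * decay γ i)
  have h2 := Nat.floor_le (a := (2 : ℝ) ^ k * decay γ (n + 1))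
    (mul_nonneg (by positivity) (decay_pos γ _).le)
  rw [hfl] at h1
  have h3 : decay γ i - decay γ (n + 1) ≤ ((2 : ℝ) ^ k)⁻¹ := by
    rw [← one_div, le_div_iff₀ (by positivity)]
    linarith
  calc _ ≤ ∑ j ∈ Finset.Ico i (n + 1), 2 ^ (γ + 1) / (γ - 1) * (decay γ j - decay γ (j + 1)) :=
        Finset.sum_le_sum fun j _ => rpow_neg_le_decay_sub hγ j
    _ = 2 ^ (γ + 1) / (γ - 1) * (decay γ i - decay γ (n + 1)) := by
        rw [← Finset.mul_sum]
        congr 1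
        have := Finset.sum_Ico_sub (decay γ) (show i ≤ n + 1 by omega)
        have h4 : ∑ j ∈ Finset.Ico i (n + 1), (decay γ j - decay γ (j + 1)) =
            - ∑ j ∈ Finset.Ico i (n + 1), (decay γ (j + 1) - decay γ j) := by
          rw [← Finset.sum_neg_distrib]
          simp
        rw [h4, this]
        ring
    _ ≤ _ := by gcongr

/-- The index of the dyadic interval that `decay γ` leaves at `j`. -/
def levelIndex (γ : ℝ) (k j : ℕ) : ℕ := ⌊(2 : ℝ) ^ k * decay γ j⌋₊

lemma levelIndex_lt {γ : ℝ} (hγ : 1 < γ) {k i j : ℕ} (hi : i ∈ levels γ k) (hij : i < j) :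
    levelIndex γ k j < levelIndex γ k i := by
  have hle : ∀ a b, a ≤ b → levelIndex γ k b ≤ levelIndex γ k a := fun a b hab =>
    Nat.floor_mono (mul_le_mul_of_nonneg_left (decay_antitone hγ hab) (by positivity))
  exact lt_of_le_of_lt (hle (i + 1) j hij)
    (lt_of_le_of_ne (hle i (i + 1) (Nat.le_succ i)) (Ne.symm hi))

lemma levelIndex_injOn {γ : ℝ} (hγ : 1 < γ) (k : ℕ) :
    Set.InjOn (levelIndex γ k) (levels γ k) := by
  intro i hi j hj h
  rcases lt_trichotomy i j with hij | hij | hij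
  · exact absurd h (levelIndex_lt hγ hi hij).ne'
  · exact hij
  · exact absurd h (levelIndex_lt hγ hj hij).ne

lemma levelIndex_pos {γ : ℝ} (hγ : 1 < γ) {k j : ℕ} (hj : j ∈ levels γ k) :
    1 ≤ levelIndex γ k j :=
  Nat.one_le_of_lt (levelIndex_lt hγ hj (Nat.lt_succ_self j))

lemma levelIndex_mul_le (γ : ℝ) (k j : ℕ) :
    (levelIndex γ k j : ℝ) * ((j : ℝ) + 1) ^ (γ - 1) ≤ 2 ^ k := by
  have h := Nat.floor_le (a := (2 : ℝ) ^ k * decay γ j)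
    (mul_nonneg (by positivity) (decay_pos γ _).le)
  have hx : (0 : ℝ) < ((j : ℝ) + 1) ^ (γ - 1) := by positivity
  calc _ ≤ (2 : ℝ) ^ k * decay γ j * ((j : ℝ) + 1) ^ (γ - 1) := by
        unfold levelIndex
        gcongr
    _ = 2 ^ k / 2 := by
        rw [decay, Real.rpow_neg (by positivity)]
        field_simp
    _ ≤ 2 ^ k := by
        have : (0 : ℝ) < 2 ^ k := by positivity
        linarith

lemma levels_finite {γ : ℝ} (hγ : 1 < γ) (k : ℕ) : (levels γ k).Finite := by
  refine Set.Finite.of_finite_image ((Set.finite_Iic (2 ^ k)).subset ?_) (levelIndex_injOn hγ k)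
  rintro _ ⟨j, -, rfl⟩
  have h := levelIndex_mul_le γ k j
  have h1 : (1 : ℝ) ≤ ((j : ℝ) + 1) ^ (γ - 1) :=
    Real.one_le_rpow (by simp) (by linarith)
  have h2 : (levelIndex γ k j : ℝ) ≤ 2 ^ k :=
    le_trans (le_mul_of_one_le_right (by positivity) h1) h
  exact_mod_cast h2

lemma sum_levels_le {γ H : ℝ} (hγ : 1 < γ) (hH : 0 ≤ H) (k : ℕ) :
    ∑ j ∈ (levels_finite hγ k).toFinset, ((j : ℝ) + 1) ^ H ≤
      (2 : ℝ) ^ ((H + 1) / γ * k) + 2 ^ (H / (γ - 1) * k) *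
        ∑ m ∈ Finset.Icc 1 ⌊(2 : ℝ) ^ ((k : ℝ) / γ)⌋₊, (m : ℝ) ^ (-(H / (γ - 1))) := by
  classical
  have hg : 0 < γ - 1 := by linarith
  have hγ0 : 0 < γ := by linarith
  set J : ℝ := (2 : ℝ) ^ ((k : ℝ) / γ) with hJ
  have hJ0 : 0 < J := by positivity
  rw [← Finset.sum_filter_add_sum_filter_not _ (fun j : ℕ => (j : ℝ) + 1 ≤ J)]
  refine add_le_add ?_ ?_
  · have hcard : (((levels_finite hγ k).toFinset.filter
        (fun j : ℕ => (j : ℝ) + 1 ≤ J)).card : ℝ) ≤ J := by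
      have : (levels_finite hγ k).toFinset.filter (fun j : ℕ => (j : ℝ) + 1 ≤ J) ⊆
          Finset.range ⌊J⌋₊ := by
        intro j hj
        have h1 := (Finset.mem_filter.1 hj).2
        have : j + 1 ≤ ⌊J⌋₊ := Nat.le_floor (by push_cast; exact h1)
        exact Finset.mem_range.2 (by omega)
      have h2 := Finset.card_le_card this
      rw [Finset.card_range] at h2
      exact le_trans (by exact_mod_cast h2) (Nat.floor_le hJ0.le)
    calc _ ≤ ∑ j ∈ (levels_finite hγ k).toFinset.filter (fun j : ℕ => (j : ℝ) + 1 ≤ J), J ^ H :=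
          Finset.sum_le_sum fun j hj =>
            Real.rpow_le_rpow (by positivity) (Finset.mem_filter.1 hj).2 hH
      _ ≤ J * J ^ H := by
          rw [Finset.sum_const, nsmul_eq_mul]
          gcongr
      _ = _ := by
          rw [mul_comm, ← Real.rpow_add_one hJ0.ne', hJ, ← Real.rpow_mul (by norm_num)]
          congr 1
          ring
  · have hterm : ∀ j ∈ (levels_finite hγ k).toFinset.filter (fun j : ℕ => ¬ (j : ℝ) + 1 ≤ J),
        ((j : ℝ) + 1) ^ H ≤
          2 ^ (H / (γ - 1) * k) * (levelIndex γ k j : ℝ) ^ (-(H / (γ - 1))) := by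
      intro j hj
      have hj1 := (Set.Finite.mem_toFinset _).1 (Finset.mem_filter.1 hj).1
      have hm : (1 : ℝ) ≤ levelIndex γ k j := by exact_mod_cast levelIndex_pos hγ hj1
      have hm0 : (0 : ℝ) < levelIndex γ k j := by linarith
      have h1 : ((j : ℝ) + 1) ^ (γ - 1) ≤ 2 ^ k / levelIndex γ k j := by
        rw [le_div_iff₀ hm0, mul_comm]
        exact levelIndex_mul_le γ k j
      have h2 := Real.rpow_le_rpow (by positivity) h1 (div_nonneg hH hg.le)
      rw [← Real.rpow_mul (by positivity), mul_div_cancel₀ _ hg.ne',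
        Real.div_rpow (by positivity) hm0.le, ← Real.rpow_natCast, ← Real.rpow_mul (by norm_num)]
        at h2
      rw [Real.rpow_neg hm0.le, ← div_eq_mul_inv, mul_comm (H / (γ - 1))]
      exact h2
    refine (Finset.sum_le_sum hterm).trans ?_
    rw [← Finset.mul_sum]
    gcongr
    have hinj : Set.InjOn (levelIndex γ k) ((levels_finite hγ k).toFinset.filter
        (fun j : ℕ => ¬ (j : ℝ) + 1 ≤ J) : Finset ℕ) := by
      intro a ha b hb
      exact levelIndex_injOn hγ k
        ((Set.Finite.mem_toFinset _).1 (Finset.mem_filter.1 (Finset.mem_coe.1 ha)).1)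
        ((Set.Finite.mem_toFinset _).1 (Finset.mem_filter.1 (Finset.mem_coe.1 hb)).1)
    rw [← Finset.sum_image (f := fun m : ℕ => (m : ℝ) ^ (-(H / (γ - 1)))) hinj]
    refine Finset.sum_le_sum_of_subset_of_nonneg ?_ fun _ _ _ => by positivity
    intro m hm
    obtain ⟨j, hj, rfl⟩ := Finset.mem_image.1 hm
    have hj1 := (Set.Finite.mem_toFinset _).1 (Finset.mem_filter.1 hj).1
    have hj2 := not_le.1 (Finset.mem_filter.1 hj).2
    refine Finset.mem_Icc.2 ⟨levelIndex_pos hγ hj1, Nat.le_floor ?_⟩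
    have hpow : J * J ^ (γ - 1) = 2 ^ k := by
      rw [mul_comm, ← Real.rpow_add_one hJ0.ne', hJ, ← Real.rpow_mul (by norm_num),
        ← Real.rpow_natCast]
      congr 1
      field_simp
      ring
    have h1 := levelIndex_mul_le γ k j
    rw [← hpow] at h1
    have h2 : J ^ (γ - 1) ≤ ((j : ℝ) + 1) ^ (γ - 1) :=
      Real.rpow_le_rpow hJ0.le hj2.le hg.le
    have h3 : (levelIndex γ k j : ℝ) * J ^ (γ - 1) ≤ J * J ^ (γ - 1) :=
      le_trans (by gcongr) h1
    exact le_of_mul_le_mul_right h3 (by positivity)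

lemma sum_Icc_rpow_neg_le {h : ℝ} (h0 : 0 ≤ h) (h1 : h < 1) (N : ℕ) :
    ∑ m ∈ Finset.Icc 1 N, (m : ℝ) ^ (-h) ≤ (1 - h)⁻¹ * (N : ℝ) ^ (1 - h) := by
  have hh : 0 < 1 - h := by linarith
  induction N with
  | zero => simp [Real.zero_rpow hh.ne']
  | succ N ih =>
    rw [Finset.sum_Icc_succ_top (by omega)]
    set x : ℝ := ((N + 1 : ℕ) : ℝ) with hx
    have hx0 : 0 < x := by positivity
    have hN : (N : ℝ) = x * (1 + -x⁻¹) := by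
      rw [hx]
      push_cast
      field_simp
      ring
    have hx1 : x⁻¹ ≤ 1 := inv_le_one_of_one_le₀ (by simp [hx])
    have hb := rpow_one_add_le_one_add_mul_self (s := -x⁻¹) (p := 1 - h) (by linarith)
      hh.le (by linarith)
    have hxp : x ^ (1 - h) = x ^ (-h) * x := by
      rw [← Real.rpow_add_one hx0.ne']
      congr 1
      ring
    have hNle : (N : ℝ) ^ (1 - h) ≤ x ^ (1 - h) - (1 - h) * x ^ (-h) := by
      rw [hN, Real.mul_rpow hx0.le (by linarith)]
      calc _ ≤ x ^ (1 - h) * (1 + (1 - h) * -x⁻¹) := by gcongr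
        _ = _ := by
          rw [hxp]
          field_simp
          ring
    calc _ ≤ (1 - h)⁻¹ * (N : ℝ) ^ (1 - h) + x ^ (-h) := by gcongr
      _ ≤ (1 - h)⁻¹ * (x ^ (1 - h) - (1 - h) * x ^ (-h)) + x ^ (-h) := by gcongr
      _ = _ := by
        field_simp
        ring

lemma exists_sum_levels_le_of_lt {γ H : ℝ} (hγ : 1 < γ) (h : γ < H + 1) :
    ∃ D : ℝ, 0 < D ∧ ∀ k, ∑ j ∈ (levels_finite hγ k).toFinset, ((j : ℝ) + 1) ^ H ≤
      D * netGrowth (H / (γ - 1)) 0 k := by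
  have hg : 0 < γ - 1 := by linarith
  have hH : 0 < H := by linarith
  have hh : 1 < H / (γ - 1) := (one_lt_div hg).2 (by linarith)
  have hsum : Summable fun m : ℕ => (m : ℝ) ^ (-(H / (γ - 1))) :=
    Real.summable_nat_rpow.2 (by linarith)
  refine ⟨1 + ∑' m : ℕ, (m : ℝ) ^ (-(H / (γ - 1))),
    add_pos_of_pos_of_nonneg one_pos (tsum_nonneg fun m => by positivity), fun k => ?_⟩
  refine (sum_levels_le hγ hH.le k).trans ?_
  have h1 : (2 : ℝ) ^ ((H + 1) / γ * k) ≤ 2 ^ (H / (γ - 1) * k) := by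
    refine Real.rpow_le_rpow_of_exponent_le (by norm_num) ?_
    gcongr ?_ * _
    rw [div_le_div_iff₀ (by linarith) hg]
    nlinarith
  have h2 := hsum.sum_le_tsum (Finset.Icc 1 ⌊(2 : ℝ) ^ ((k : ℝ) / γ)⌋₊)
    fun m _ => by positivity
  have h3 := mul_le_mul_of_nonneg_left h2
    (by positivity : (0 : ℝ) ≤ 2 ^ (H / (γ - 1) * k))
  simp only [netGrowth, pow_zero, mul_one]
  linarith

lemma exists_sum_levels_le_of_eq {γ H : ℝ} (hγ : 1 < γ) (h : γ = H + 1) :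
    ∃ D : ℝ, 0 < D ∧ ∀ k, ∑ j ∈ (levels_finite hγ k).toFinset, ((j : ℝ) + 1) ^ H ≤
      D * netGrowth 1 1 k := by
  have hH : 0 < H := by linarith
  refine ⟨2, by norm_num, fun k => ?_⟩
  refine (sum_levels_le hγ hH.le k).trans ?_
  rw [← h, show γ - 1 = H by linarith, div_self (by linarith), div_self hH.ne', one_mul]
  set J : ℝ := (2 : ℝ) ^ ((k : ℝ) / γ) with hJ
  have hsum : ∑ m ∈ Finset.Icc 1 ⌊J⌋₊, (m : ℝ) ^ (-(1 : ℝ)) ≤ 1 + k := by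
    have h1 := harmonic_floor_le_one_add_log J
      (Real.one_le_rpow (by norm_num) (div_nonneg (by positivity) (by linarith)))
    have h2 : ∑ m ∈ Finset.Icc 1 ⌊J⌋₊, (m : ℝ) ^ (-(1 : ℝ)) = (harmonic ⌊J⌋₊ : ℝ) := by
      rw [harmonic_eq_sum_Icc]
      push_cast
      exact Finset.sum_congr rfl fun m _ => Real.rpow_neg_one _
    rw [h2]
    have h3 : Real.log J ≤ k := by
      rw [hJ, Real.log_rpow (by norm_num)]
      have : (k : ℝ) / γ ≤ k := div_le_self (by positivity) hγ.le
      have := Real.log_two_lt_d9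
      have : 0 < Real.log 2 := Real.log_pos (by norm_num)
      have : (0 : ℝ) ≤ k / γ := div_nonneg (by positivity) (by linarith)
      nlinarith
    linarith
  have h1 := mul_le_mul_of_nonneg_left hsum (by positivity : (0 : ℝ) ≤ 2 ^ (k : ℝ))
  have h2 : (0 : ℝ) ≤ 2 ^ (k : ℝ) * k := by positivity
  have h3 : (0 : ℝ) ≤ 2 ^ (k : ℝ) := by positivity
  simp only [netGrowth, pow_one, one_mul]
  linarith

lemma exists_sum_levels_le_of_gt {γ H : ℝ} (hγ : 1 < γ) (hH : 0 ≤ H) (h : H + 1 < γ) :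
    ∃ D : ℝ, 0 < D ∧ ∀ k, ∑ j ∈ (levels_finite hγ k).toFinset, ((j : ℝ) + 1) ^ H ≤
      D * netGrowth ((H + 1) / γ) 0 k := by
  have hg : 0 < γ - 1 := by linarith
  have hγ0 : 0 < γ := by linarith
  have hh : H / (γ - 1) < 1 := (div_lt_one hg).2 (by linarith)
  have hh' : 0 < 1 - H / (γ - 1) := by linarith
  refine ⟨1 + (1 - H / (γ - 1))⁻¹, by positivity, fun k => ?_⟩
  refine (sum_levels_le hγ hH k).trans ?_
  set J : ℝ := (2 : ℝ) ^ ((k : ℝ) / γ) with hJ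
  have hJ0 : 0 < J := by positivity
  have h1 : ∑ m ∈ Finset.Icc 1 ⌊J⌋₊, (m : ℝ) ^ (-(H / (γ - 1))) ≤
      (1 - H / (γ - 1))⁻¹ * J ^ (1 - H / (γ - 1)) := by
    refine (sum_Icc_rpow_neg_le (div_nonneg hH hg.le) hh _).trans ?_
    have := Nat.floor_le hJ0.le
    gcongr
  have h2 : (2 : ℝ) ^ (H / (γ - 1) * k) * J ^ (1 - H / (γ - 1)) = 2 ^ ((H + 1) / γ * k) := by
    rw [hJ, ← Real.rpow_mul (by norm_num), ← Real.rpow_add (by norm_num)]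
    congr 1
    field_simp
    ring
  have h3 := mul_le_mul_of_nonneg_left h1 (by positivity : (0 : ℝ) ≤ 2 ^ (H / (γ - 1) * k))
  simp only [netGrowth, pow_zero, mul_one]
  calc _ ≤ _ := add_le_add le_rfl h3
    _ = 2 ^ ((H + 1) / γ * k) + (1 - H / (γ - 1))⁻¹ *
        ((2 : ℝ) ^ (H / (γ - 1) * k) * J ^ (1 - H / (γ - 1))) := by ring
    _ = _ := by
      rw [h2]
      ring

lemma entropyNumber_le_norm_add_one {X Y : Type} [NormedAddCommGroup X] [NormedSpace ℝ X]
    [NormedAddCommGroup Y] [NormedSpace ℝ Y] (n : ℕ) (V : X →L[ℝ] Y) :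
    entropyNumber n V ≤ ‖V‖ + 1 := by
  refine csInf_le ⟨0, fun ε hε => hε.1.le⟩ ⟨by positivity, {0}, ?_, fun x hx => ?_⟩
  · simpa using Nat.one_le_two_pow
  · refine ⟨0, by simp, ?_⟩
    rw [sub_zero]
    have := V.le_opNorm x
    have := mul_le_mul_of_nonneg_left hx (norm_nonneg V)
    linarith

lemma exists_le_rpow_mul_log_rpow {e : ℕ → ℝ} {a A B M κ r : ℝ} {b : ℕ} (ha : 0 < a) (hA : 0 < A)
    (hB : 0 < B) (hM : 0 < M) (hκ : 0 < κ) (hr : 0 ≤ r) (heM : ∀ n, e n ≤ M)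
    (he : ∀ m n : ℕ, A * netGrowth a b m + 1 ≤ n →
      e n ≤ B * (2 ^ (-(κ * m)) * netGrowth a b m ^ (-r))) :
    ∃ C, 0 < C ∧ ∀ n : ℕ, 2 ≤ n →
      e n ≤ C * ((n : ℝ) ^ (-(κ / a) - r) * Real.log n ^ (κ * b / a)) := by
  have hl2 : 0 < Real.log 2 := Real.log_pos (by norm_num)
  set E : ℝ := A * 2 ^ (a + b) + 1 with hE
  have hE0 : 0 < E := by positivity
  set G : ℝ := (1 + |Real.log A| / Real.log 2) / (a * Real.log 2) + 1 / Real.log 2 with hG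
  have hG0 : 0 < G := by positivity
  set y : ℝ := κ * b / a with hy
  have hy0 : 0 ≤ y := by positivity
  set x : ℝ := κ / a + r with hx
  have hx0 : 0 ≤ x := by positivity
  rw [show -(κ / a) - r = -x by rw [hx]; ring]
  set C₁ : ℝ := M * ((A + 1) ^ x * (Real.log 2 ^ y)⁻¹) with hC₁
  set C₂ : ℝ := B * (E ^ x * G ^ y) with hC₂
  have hC₁0 : 0 < C₁ := by positivity
  have hC₂0 : 0 < C₂ := by positivity
  refine ⟨C₁ + C₂, by positivity, fun n hn => ?_⟩
  have hn2 : (2 : ℝ) ≤ n := by exact_mod_cast hn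
  have hn0 : (0 : ℝ) < n := by linarith
  have hlog : Real.log 2 ≤ Real.log n := Real.log_le_log (by norm_num) hn2
  have hlog0 : 0 < Real.log n := by linarith
  have hprod : 0 < (n : ℝ) ^ (-x) * Real.log n ^ y := by positivity
  rw [add_mul]
  by_cases hsmall : (n : ℝ) ≤ A + 1
  · have h1 : (A + 1) ^ (-x) ≤ (n : ℝ) ^ (-x) :=
      Real.rpow_le_rpow_of_nonpos hn0 hsmall (by linarith)
    have h2 : Real.log 2 ^ y ≤ Real.log n ^ y := Real.rpow_le_rpow hl2.le hlog hy0
    have h3 : M ≤ C₁ * ((n : ℝ) ^ (-x) * Real.log n ^ y) := by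
      calc M = C₁ * ((A + 1) ^ (-x) * Real.log 2 ^ y) := by
            rw [hC₁, Real.rpow_neg (by positivity)]
            field_simp
        _ ≤ _ := by gcongr
    have h4 : 0 < C₂ * ((n : ℝ) ^ (-x) * Real.log n ^ y) := by positivity
    linarith [heM n]
  · push Not at hsmall
    have hex : ∃ m : ℕ, (n : ℝ) < A * netGrowth a b m + 1 := by
      have ht : Filter.Tendsto (fun m : ℕ => ((2 : ℝ) ^ a) ^ m) Filter.atTop Filter.atTop :=
        tendsto_pow_atTop_atTop_of_one_lt (Real.one_lt_rpow (by norm_num) ha)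
      obtain ⟨m, hm⟩ := (ht.eventually_gt_atTop (n / A)).exists
      refine ⟨m, ?_⟩
      have h1 : ((2 : ℝ) ^ a) ^ m ≤ netGrowth a b m := by
        rw [netGrowth, ← Real.rpow_natCast, ← Real.rpow_mul (by norm_num)]
        refine le_mul_of_one_le_right (by positivity) (one_le_pow₀ (by simp))
      rw [div_lt_iff₀ hA] at hm
      nlinarith
    classical
    obtain ⟨m, hm⟩ : ∃ m, Nat.find hex = m + 1 := by
      refine Nat.exists_eq_succ_of_ne_zero fun h0 => ?_
      have := Nat.find_spec hex
      rw [h0] at this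
      simp only [netGrowth, CharP.cast_eq_zero, mul_zero, Real.rpow_zero, zero_add, one_pow,
        mul_one] at this
      linarith
    have hlt := Nat.find_spec hex
    rw [hm] at hlt
    have hle : A * netGrowth a b m + 1 ≤ n := not_lt.1 (Nat.find_min hex (m := m) (by omega))
    have hone := one_le_netGrowth ha b m
    set N : ℝ := netGrowth a b m with hN
    have hN0 : 0 < N := by linarith
    have hnE : n / E ≤ N := by
      rw [div_le_iff₀ hE0, hE]
      have h1 := netGrowth_add_le (a := a) b m 1
      rw [Nat.cast_one, mul_one, ← hN] at h1
      have h2 := mul_le_mul_of_nonneg_left h1 hA.le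
      linarith
    have hmlog : (m : ℝ) + 1 ≤ G * Real.log n := by
      have h1 : (2 : ℝ) ^ (a * m) ≤ N := by
        rw [hN, netGrowth]
        exact le_mul_of_one_le_right (by positivity) (one_le_pow₀ (by simp))
      have h2 : A * 2 ^ (a * m) ≤ n := by nlinarith
      have h3 := Real.log_le_log (by positivity) h2
      rw [Real.log_mul hA.ne' (by positivity), Real.log_rpow (by norm_num)] at h3
      have h4 : |Real.log A| ≤ |Real.log A| / Real.log 2 * Real.log n := by
        rw [div_mul_eq_mul_div, le_div_iff₀ hl2]
        gcongr
      have h5 : (m : ℝ) ≤ (1 + |Real.log A| / Real.log 2) / (a * Real.log 2) * Real.log n := by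
        rw [div_mul_eq_mul_div, le_div_iff₀ (by positivity)]
        have := neg_abs_le (Real.log A)
        linarith
      have h6 : 1 ≤ 1 / Real.log 2 * Real.log n := by
        rw [one_div, inv_mul_eq_div, le_div_iff₀ hl2]
        linarith
      rw [hG, add_mul]
      linarith
    have hpow : (2 : ℝ) ^ (-(κ * m)) = N ^ (-(κ / a)) * ((m : ℝ) + 1) ^ y := by
      rw [hN, netGrowth, Real.mul_rpow (by positivity) (by positivity), ← Real.rpow_mul
        (by norm_num), ← Real.rpow_natCast ((m : ℝ) + 1), ← Real.rpow_mul (by positivity), mul_assoc,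
        ← Real.rpow_add (by positivity), hy, show (b : ℝ) * -(κ / a) + κ * b / a = 0 by ring,
        Real.rpow_zero, mul_one]
      congr 1
      field_simp
    have hNx : N ^ (-x) ≤ E ^ x * (n : ℝ) ^ (-x) := by
      calc N ^ (-x) ≤ (n / E) ^ (-x) :=
            Real.rpow_le_rpow_of_nonpos (by positivity) hnE (by linarith)
        _ = _ := by
          rw [Real.div_rpow hn0.le hE0.le, Real.rpow_neg hE0.le]
          field_simp
    have hmy : ((m : ℝ) + 1) ^ y ≤ G ^ y * Real.log n ^ y := by
      rw [← Real.mul_rpow hG0.le hlog0.le]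
      exact Real.rpow_le_rpow (by positivity) hmlog hy0
    have hmain : e n ≤ C₂ * ((n : ℝ) ^ (-x) * Real.log n ^ y) := by
      calc e n ≤ B * (2 ^ (-(κ * m)) * N ^ (-r)) := he m n hle
        _ = B * (N ^ (-x) * ((m : ℝ) + 1) ^ y) := by
          rw [hpow, show -x = -(κ / a) + -r by rw [hx]; ring, Real.rpow_add hN0]
          ring
        _ ≤ B * (E ^ x * (n : ℝ) ^ (-x) * (G ^ y * Real.log n ^ y)) := by gcongr
        _ = _ := by
          rw [hC₂]
          ring
    have h4 : 0 < C₁ * ((n : ℝ) ^ (-x) * Real.log n ^ y) := by positivity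
    linarith

section Tree

variable {T : Type} [PartialOrder T] [OrderBot T]

open Classical in
/-- The nodes whose generation lies in `levels γ k`. -/
def levelNodes (htree : IsTree T) {γ : ℝ} (hγ : 1 < γ) (k : ℕ) : Finset T :=
  (levels_finite hγ k).toFinset.biUnion fun j => (finite_gen_eq htree j).toFinset

lemma mem_levelNodes (htree : IsTree T) {γ : ℝ} (hγ : 1 < γ) {k : ℕ} {t : T} :
    t ∈ levelNodes htree hγ k ↔ gen t ∈ levels γ k := by
  simp [levelNodes]

lemma card_levelNodes_le (htree : IsTree T) {γ c H : ℝ} (hγ : 1 < γ) (hc : 0 < c) (hH : 0 ≤ H)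
    (hR : ∀ n : ℕ, 1 ≤ n → (Nat.card {t : T | gen t = n} : ℝ) ≤ c * (n : ℝ) ^ H) (k : ℕ) :
    ((levelNodes htree hγ k).card : ℝ) ≤
      (c + 1) * ∑ j ∈ (levels_finite hγ k).toFinset, ((j : ℝ) + 1) ^ H := by
  classical
  have hcard : ∀ j, ((finite_gen_eq (T := T) htree j).toFinset.card : ℝ) ≤
      (c + 1) * ((j : ℝ) + 1) ^ H := by
    intro j
    rw [← Set.ncard_eq_toFinset_card _ (finite_gen_eq htree j)]
    rcases Nat.eq_zero_or_pos j with rfl | hj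
    · have h1 : {t : T | gen t = 0}.ncard ≤ 1 := by
        refine (Set.ncard_le_ncard (fun t ht => eq_bot_of_gen_eq_zero htree ht)
          (Set.finite_singleton (⊥ : T))).trans (Set.ncard_singleton _).le
      have h2 : ({t : T | gen t = 0}.ncard : ℝ) ≤ 1 := by exact_mod_cast h1
      simp only [CharP.cast_eq_zero, zero_add, Real.one_rpow]
      linarith
    · rw [← Nat.card_coe_set_eq]
      refine (hR j hj).trans ?_
      gcongr <;> linarith
  rw [Finset.mul_sum]
  refine le_trans ?_ (Finset.sum_le_sum fun j _ => hcard j)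
  exact_mod_cast Finset.card_biUnion_le

lemma exists_rpow_le_weight (htree : IsTree T) {q : ℝ} (hq : 1 < q) {α σ : T → ℝ}
    (hα : ∀ t, 0 < α t) (hσpos : ∀ t, 0 < σ t) {c γ : ℝ} (hc : 0 < c) (hγ : 1 < γ)
    (hw : ∀ t : T, 1 ≤ gen t → α t * σ t ≤ c * (gen t : ℝ) ^ (-(γ / q))) :
    ∃ W, 0 < W ∧ ∀ t, (α t * σ t) ^ q ≤ W * ((gen t : ℝ) + 1) ^ (-γ) := by
  have hq0 : 0 < q := by linarith
  have hroot : 0 < α ⊥ * σ ⊥ := mul_pos (hα _) (hσpos _)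
  refine ⟨(α ⊥ * σ ⊥) ^ q + c ^ q * 2 ^ γ, by positivity, fun t => ?_⟩
  rcases Nat.eq_zero_or_pos (gen t) with h | h
  · obtain rfl := eq_bot_of_gen_eq_zero htree h
    rw [h]
    simp only [CharP.cast_eq_zero, zero_add, Real.one_rpow, mul_one]
    have : 0 < c ^ q * 2 ^ γ := by positivity
    linarith
  · have hg : (1 : ℝ) ≤ gen t := by exact_mod_cast h
    have hg0 : (0 : ℝ) < gen t := by linarith
    have h1 := Real.rpow_le_rpow (mul_pos (hα t) (hσpos t)).le (hw t h) hq0.le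
    rw [Real.mul_rpow hc.le (by positivity), ← Real.rpow_mul hg0.le,
      show -(γ / q) * q = -γ by field_simp] at h1
    have h4 := mul_le_mul_of_nonneg_left (rpow_neg_le_two_rpow_mul (γ := γ) (by linarith) hg) (by positivity : 0 ≤ c ^ q)
    have h5 : 0 < (α ⊥ * σ ⊥) ^ q * ((gen t : ℝ) + 1) ^ (-γ) := by positivity
    linarith

lemma exists_entropyNumber_le (htree : IsTree T) {q : ℝ} (hq : 1 < q) {α σ : T → ℝ}
    (hα : ∀ t, 0 < α t) (hσpos : ∀ t, 0 < σ t) (hσmono : ∀ ⦃t s : T⦄, t ≤ s → σ s ≤ σ t)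
    [Fact (1 ≤ ENNReal.ofReal q)] (V : ellOne T →L[ℝ] ellQ T q)
    (hV : ∀ (x : ellOne T) (t : T), (V x : ∀ _ : T, ℝ) t =
      α t * ∑' s : {s : T // t ≤ s}, σ s.1 * (x : ∀ _ : T, ℝ) s.1)
    {H c γ : ℝ} (hH : 0 ≤ H) (hc : 0 < c) (hγ : 1 < γ)
    (hR : ∀ n : ℕ, 1 ≤ n → (Nat.card {t : T | gen t = n} : ℝ) ≤ c * (n : ℝ) ^ H)
    (hw : ∀ t : T, 1 ≤ gen t → α t * σ t ≤ c * (gen t : ℝ) ^ (-(γ / q)))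
    {p : ℝ} (hp : p = min 2 q) {a D : ℝ} {b : ℕ} (ha : 0 < a) (hD : 0 < D)
    (hsum : ∀ k, ∑ j ∈ (levels_finite hγ k).toFinset, ((j : ℝ) + 1) ^ H ≤ D * netGrowth a b k) :
    ∃ C, 0 < C ∧ ∀ n : ℕ, 2 ≤ n → entropyNumber n V ≤
      C * ((n : ℝ) ^ (-(1 / q / a) - (1 - 1 / p)) * Real.log n ^ (1 / q * b / a)) := by
  classical
  have hq0 : 0 < q := by linarith
  have hg : 0 < γ - 1 := by linarith
  have hp1 : 1 < p := by
    rw [hp]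
    exact lt_min (by norm_num) hq
  have hr : 0 < 1 - 1 / p := by
    have : 1 / p < 1 := (div_lt_one (by linarith)).2 hp1
    linarith
  obtain ⟨C, hC, hY⟩ := ellQ_maureyApprox (T := T) hq hp
  obtain ⟨W, hW, hweight⟩ := exists_rpow_le_weight htree hq hα hσpos hc hγ hw
  set Q : ℝ := W * (2 ^ (γ + 1) / (γ - 1)) with hQ
  have hQ0 : 0 < Q := by positivity
  set u : ℕ → T → ellQ T q := fun k s => branchVec htree q α σ {v | gen v ∈ levels γ k} s with hu
  have hnorm : ∀ k s, ‖u k s‖ ≤ Q ^ (1 / q) * 2 ^ (-(1 / q * (k : ℝ))) := by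
    intro k s
    have h1 : ‖u k s‖ ^ q ≤ Q * ((2 : ℝ) ^ k)⁻¹ := by
      refine norm_branchVec_rpow_le htree hq hα hσpos hσmono
        (w := fun j => W * ((j : ℝ) + 1) ^ (-γ)) (fun j => by positivity) hweight (by positivity)
        (fun i n hin hj => ?_) s
      rw [← Finset.mul_sum, hQ, mul_assoc]
      exact mul_le_mul_of_nonneg_left (sum_rpow_neg_le_of_notMem_levels hγ hin hj) hW.le
    have h2 := Real.rpow_le_rpow (by positivity) h1 (by positivity : 0 ≤ 1 / q)
    rw [← Real.rpow_mul (norm_nonneg _), mul_one_div_cancel hq0.ne', Real.rpow_one,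
      Real.mul_rpow hQ0.le (by positivity), ← Real.rpow_natCast, ← Real.rpow_neg (by norm_num),
      ← Real.rpow_mul (by norm_num)] at h2
    convert h2 using 3
    ring
  obtain ⟨A, B, hA, hB, hAB⟩ := entropyNumber_le_of_scheme V hC hr (by positivity : 0 < 1 / q) ha
    (D := (c + 1) * (D * 2 ^ (a + b))) (b := b) (by positivity)
    (by positivity : 0 < Q ^ (1 / q)) hY u (fun k => levelNodes htree hγ (k + 1))
    (fun s => by
      simp only [hu, levels_zero hγ]
      exact branchVec_empty htree V hV s)
    hnorm
    (fun k s => by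
      rcases branchVec_sub htree q (α := α) hσpos hσmono
        (S := {v | gen v ∈ levels γ k}) (S' := {v | gen v ∈ levels γ (k + 1)})
        (fun v hv => levels_mono_succ γ k hv) s with h | ⟨v, hv, h⟩
      · exact Or.inl h
      · exact Or.inr ⟨v, (mem_levelNodes htree hγ).2 hv, h⟩)
    (fun k => by
      refine (card_levelNodes_le htree hγ hc hH hR (k + 1)).trans ?_
      have h1 := netGrowth_add_le (a := a) b k 1
      rw [Nat.cast_one, mul_one] at h1
      calc _ ≤ (c + 1) * (D * netGrowth a b (k + 1)) := by
            gcongr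
            exact hsum (k + 1)
        _ ≤ (c + 1) * (D * (netGrowth a b k * 2 ^ (a + b))) := by gcongr
        _ = _ := by ring)
  exact exists_le_rpow_mul_log_rpow ha hA hB (by positivity : 0 < ‖V‖ + 1)
    (by positivity : 0 < 1 / q) hr.le (fun n => entropyNumber_le_norm_add_one n V) hAB

end Tree

theorem stmt13 {T : Type} [Countable T] [PartialOrder T] [OrderBot T]
    (htree : IsTree T) (q : ℝ) (hq : 1 < q)
    (α σ : T → ℝ) (hα : ∀ t, 0 < α t) (hσpos : ∀ t, 0 < σ t)
    (hσmono : ∀ ⦃t s : T⦄, t ≤ s → σ s ≤ σ t)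
    (K : ℝ) (hK : ∀ s : T, (∑ᶠ r ∈ Set.Iic s, α r ^ q) ^ (1 / q) * σ s ≤ K)
    [Fact (1 ≤ ENNReal.ofReal q)]
    (V : ellOne T →L[ℝ] ellQ T q)
    (hV : ∀ (x : ellOne T) (t : T), (V x : ∀ _ : T, ℝ) t =
      α t * ∑' s : {s : T // t ≤ s}, σ s.1 * (x : ∀ _ : T, ℝ) s.1)
    (H c γ : ℝ) (hH : 0 ≤ H) (hc : 0 < c) (hγ : 1 < γ)
    (hR : ∀ n : ℕ, 1 ≤ n → (Nat.card {t : T | gen t = n} : ℝ) ≤ c * (n : ℝ) ^ H)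
    (hw : ∀ t : T, 1 ≤ gen t → α t * σ t ≤ c * (gen t : ℝ) ^ (-(γ / q)))
    (p p' : ℝ) (hp : p = min 2 q) (hp' : 1 / p' = 1 - 1 / p) :
    ∃ C > 0, ∀ n : ℕ, 2 ≤ n →
      (γ < H + 1 →
        entropyNumber n V ≤ C * (n : ℝ) ^ (-((γ - 1) / (q * H)) - 1 / p')) ∧
      (γ = H + 1 →
        entropyNumber n V ≤
          C * (n : ℝ) ^ (-(1 / q) - 1 / p') * Real.log n ^ (1 / q)) ∧
      (H + 1 < γ →
        entropyNumber n V ≤ C * (n : ℝ) ^ (-(γ / (q * (H + 1))) - 1 / p')) := by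
  have hq0 : 0 < q := by linarith
  have hg : 0 < γ - 1 := by linarith
  rw [hp']
  rcases lt_trichotomy γ (H + 1) with h | h | h
  · have hH0 : 0 < H := by linarith
    obtain ⟨D, hD, hsum⟩ := exists_sum_levels_le_of_lt hγ h
    obtain ⟨C, hC, he⟩ := exists_entropyNumber_le htree hq hα hσpos hσmono V hV hH hc hγ hR hw hp
      (by positivity) hD hsum
    refine ⟨C, hC, fun n hn => ⟨fun _ => ?_, fun h' => absurd h' h.ne,
      fun h' => absurd h' h.not_gt⟩⟩
    convert he n hn using 2
    rw [Nat.cast_zero, mul_zero, zero_div, Real.rpow_zero, mul_one]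
    congr 3
    field_simp
  · obtain ⟨D, hD, hsum⟩ := exists_sum_levels_le_of_eq hγ h
    obtain ⟨C, hC, he⟩ := exists_entropyNumber_le htree hq hα hσpos hσmono V hV hH hc hγ hR hw hp
      one_pos hD hsum
    refine ⟨C, hC, fun n hn => ⟨fun h' => absurd h h'.ne, fun _ => ?_,
      fun h' => absurd h h'.ne'⟩⟩
    simpa [mul_assoc] using he n hn
  · obtain ⟨D, hD, hsum⟩ := exists_sum_levels_le_of_gt hγ hH h
    obtain ⟨C, hC, he⟩ := exists_entropyNumber_le htree hq hα hσpos hσmono V hV hH hc hγ hR hw hp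
      (div_pos (by linarith) (by linarith)) hD hsum
    refine ⟨C, hC, fun n hn => ⟨fun h' => absurd h' h.not_gt, fun h' => absurd h' h.ne',
      fun _ => ?_⟩⟩
    convert he n hn using 2
    rw [Nat.cast_zero, mul_zero, zero_div, Real.rpow_zero, mul_one]
    congr 3
    field_simp
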